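/- Fix indices j₁ < j₂ < ⋯ < j_k ≤ n. Over a finite-dimensional hereditary algebra, the number of complete exceptional sequences (E₁,…,Eₙ) in which each of E_{j₁},…,E_{j_k} is both relatively projective and relatively injective equals the number of complete exceptional sequences whose last k terms E_{n−k+1},…,Eₙ are all projective modules. In particular this count is independent of the choice of indices j₁,…,j_k. -/

import Mathlib

open CategoryTheory

universe u

variable {A : Type u} [Ring A]

namespace ExcSeq

/-- `Hom(X, Y) = 0`. -/
def homZero (X Y : ModuleCat.{u} A) : Prop := ∀ f : X ⟶ Y, f = 0

/-- `Ext¹(X, Y) = 0`: every short exact sequence `0 → Y → E → X → 0` splits. -/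
def extZero (X Y : ModuleCat.{u} A) : Prop :=
  ∀ (E : ModuleCat.{u} A) (i : Y ⟶ E) (p : E ⟶ X) (w : i ≫ p = 0),
    (ShortComplex.mk i p w).ShortExact → ∃ s : X ⟶ E, s ≫ p = 𝟙 X

/-- `Y` belongs to the right perpendicular category `X^⊥`. -/
def rperp (X Y : ModuleCat.{u} A) : Prop := homZero X Y ∧ extZero X Y

/-- `Y` belongs to the left perpendicular category `^⊥X`. -/
def lperp (X Y : ModuleCat.{u} A) : Prop := homZero Y X ∧ extZero Y X

/-- An exceptional module: finitely generated, rigid, with division algebra endomorphism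
ring (in particular nonzero and indecomposable). -/
def ExceptionalMod (X : ModuleCat.{u} A) : Prop :=
  Module.Finite A X ∧ extZero X X ∧ Nontrivial X ∧ ∀ f : X ⟶ X, f ≠ 0 → IsIso f

/-- An exceptional sequence `(E 0, …, E (n-1))`. -/
def IsExcSeq {n : ℕ} (E : Fin n → ModuleCat.{u} A) : Prop :=
  (∀ i, ExceptionalMod (E i)) ∧ ∀ i j : Fin n, i < j → rperp (E j) (E i)

/-- A complete exceptional sequence: an exceptional sequence of maximal length. -/
def CompleteES {n : ℕ} (E : Fin n → ModuleCat.{u} A) : Prop :=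
  IsExcSeq E ∧ ∀ (m : ℕ) (F : Fin m → ModuleCat.{u} A), IsExcSeq F → m ≤ n

/-- The wide subcategory `𝒜ₖ = (E_{k+1} ⊕ ⋯ ⊕ Eₙ)^⊥`. -/
def Aperp {n : ℕ} (E : Fin n → ModuleCat.{u} A) (k : Fin n) (X : ModuleCat.{u} A) : Prop :=
  ∀ j : Fin n, k < j → rperp (E j) X

/-- The wide subcategory `ℬₖ = ^⊥(E₁ ⊕ ⋯ ⊕ E_{k-1})`. -/
def Bperp {n : ℕ} (E : Fin n → ModuleCat.{u} A) (k : Fin n) (X : ModuleCat.{u} A) : Prop :=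
  ∀ j : Fin n, j < k → lperp (E j) X

/-- `X` is a projective object of the subcategory (given by the predicate) `C`. -/
def ProjIn (C : ModuleCat.{u} A → Prop) (X : ModuleCat.{u} A) : Prop :=
  C X ∧ ∀ (Y Z : ModuleCat.{u} A), C Y → C Z → ∀ p : Y ⟶ Z, Epi p →
    ∀ f : X ⟶ Z, ∃ g : X ⟶ Y, g ≫ p = f

/-- `X` is an injective object of the subcategory (given by the predicate) `C`. -/
def InjIn (C : ModuleCat.{u} A → Prop) (X : ModuleCat.{u} A) : Prop :=
  C X ∧ ∀ (Y Z : ModuleCat.{u} A), C Y → C Z → ∀ i : Y ⟶ Z, Mono i →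
    ∀ f : Y ⟶ X, ∃ g : Z ⟶ X, i ≫ g = f

/-- `E k` is relatively projective in the exceptional sequence `E`. -/
def RelProj {n : ℕ} (E : Fin n → ModuleCat.{u} A) (k : Fin n) : Prop :=
  ProjIn (Aperp E k) (E k)

/-- `E k` is relatively injective in the exceptional sequence `E`. -/
def RelInj {n : ℕ} (E : Fin n → ModuleCat.{u} A) (k : Fin n) : Prop :=
  InjIn (Bperp E k) (E k)

/-- `Λ` is hereditary: every submodule of a projective module is projective. -/
def Hereditary (A : Type u) [Ring A] : Prop :=
  ∀ (P : ModuleCat.{u} A), Projective P →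
    ∀ S : Submodule A P, Projective (ModuleCat.of A S)

/-- The simple module `S` is in the support of `M`, i.e. `S` is (isomorphic to) a
composition factor (subquotient) of `M`. -/
def InSupport (S M : ModuleCat.{u} A) : Prop :=
  ∃ (N₁ N₂ : Submodule A M), N₁ ≤ N₂ ∧
    Nonempty ((ModuleCat.of A (N₂ ⧸ (Submodule.comap N₂.subtype N₁))) ≅ S)


/-- The setoid on sequences of modules identifying termwise isomorphic sequences. -/
def isoSetoid (n : ℕ) : Setoid (Fin n → ModuleCat.{u} A) where
  r E F := ∀ i, Nonempty (E i ≅ F i)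
  iseqv := ⟨fun _ i => ⟨Iso.refl _⟩, fun h i => ⟨(h i).some.symm⟩,
    fun h h' i => ⟨(h i).some.trans ((h' i).some)⟩⟩

/-- The number of isomorphism classes of sequences of modules belonging to `S`. -/
noncomputable def isoClassCount {n : ℕ} (S : Set (Fin n → ModuleCat.{u} A)) : ℕ :=
  Nat.card (Quotient (Setoid.comap (Subtype.val : S → (Fin n → ModuleCat.{u} A))
    (isoSetoid n)))

end ExcSeq
open CategoryTheory
open Abelian
namespace ExcSeq

section basic
variable {A : Type u} [Ring A]

/-- short exactness, packaged -/
def SE {X Y Z : ModuleCat.{u} A} (i : X ⟶ Y) (p : Y ⟶ Z) : Prop :=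
  ∃ w : i ≫ p = 0, (ShortComplex.mk i p w).ShortExact

theorem SE.mono {X Y Z : ModuleCat.{u} A} {i : X ⟶ Y} {p : Y ⟶ Z} (h : SE i p) : Mono i :=
  h.2.mono_f
theorem SE.epi {X Y Z : ModuleCat.{u} A} {i : X ⟶ Y} {p : Y ⟶ Z} (h : SE i p) : Epi p :=
  h.2.epi_g
theorem SE.w {X Y Z : ModuleCat.{u} A} {i : X ⟶ Y} {p : Y ⟶ Z} (h : SE i p) : i ≫ p = 0 := h.1

theorem SE.of_mono {X Y : ModuleCat.{u} A} (i : X ⟶ Y) [Mono i] :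
    SE i (Limits.cokernel.π i) :=
  ⟨Limits.cokernel.condition i, ShortComplex.ShortExact.mk'
    (ShortComplex.exact_of_g_is_cokernel _ (Limits.cokernelIsCokernel i)) ‹_› inferInstance⟩

theorem SE.of_epi {X Y : ModuleCat.{u} A} (p : X ⟶ Y) [Epi p] :
    SE (Limits.kernel.ι p) p :=
  ⟨Limits.kernel.condition p, ShortComplex.ShortExact.mk'
    (ShortComplex.exact_of_f_is_kernel _ (Limits.kernelIsKernel p)) inferInstance ‹_›⟩

theorem factor {X Y : ModuleCat.{u} A} (f : X ⟶ Y) :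
    ∃ (N I Q : ModuleCat.{u} A) (ι : N ⟶ X) (p : X ⟶ I) (i : I ⟶ Y) (π : Y ⟶ Q),
      SE ι p ∧ SE i π ∧ p ≫ i = f :=
  ⟨_, _, _, Limits.kernel.ι (Abelian.factorThruImage f), Abelian.factorThruImage f,
    Abelian.image.ι f, Limits.cokernel.π (Abelian.image.ι f), SE.of_epi _, SE.of_mono _,
    Abelian.image.fac f⟩

theorem exists_proj (X : ModuleCat.{u} A) :
    ∃ (S P : ModuleCat.{u} A) (i : S ⟶ P) (p : P ⟶ X), Projective P ∧ SE i p :=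
  ⟨_, _, _, Projective.π X, inferInstance, SE.of_epi _⟩

theorem homZero_iff (X Y : ModuleCat.{u} A) : homZero X Y ↔ ∀ e : Ext X Y 0, e = 0 := by
  constructor
  · intro h e
    obtain ⟨f, rfl⟩ := (Ext.mk₀_bijective X Y).2 e
    rw [h f]; simp
  · intro h f
    have := h (Ext.mk₀ f)
    exact (Ext.mk₀_bijective X Y).1 (by simpa using this)

theorem extZero_of {X Y : ModuleCat.{u} A} (h : ∀ e : Ext X Y 1, e = 0) : extZero X Y := by
  intro E i p w hS
  obtain ⟨x, hx⟩ := Ext.covariant_sequence_exact₃ X hS (Ext.mk₀ (𝟙 X)) (zero_add 1) (h _)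
  obtain ⟨s, rfl⟩ := (Ext.mk₀_bijective _ _).2 x
  refine ⟨s, (Ext.mk₀_bijective X X).1 ?_⟩
  simpa using hx

theorem extZero_iff (X Y : ModuleCat.{u} A) : extZero X Y ↔ ∀ e : Ext X Y 1, e = 0 := by
  refine ⟨?_, extZero_of⟩
  intro h e
  obtain ⟨S, P, i, p, hP, w, hS⟩ := exists_proj X
  obtain ⟨f, hf⟩ := Ext.contravariant_sequence_exact₃ hS (Y := Y) e
    (Ext.eq_zero_of_projective _) (add_zero 1)
  obtain ⟨f, rfl⟩ := (Ext.mk₀_bijective _ _).2 f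
  simp only at f hf
  have : Mono i := hS.mono_f
  have hepi : Epi p := hS.epi_g
  let p' : Limits.pushout i f ⟶ X := Limits.pushout.desc p 0 (by simp [w])
  have w' : Limits.pushout.inr i f ≫ p' = 0 := Limits.pushout.inr_desc _ _ _
  have hp' : Limits.pushout.inl i f ≫ p' = p := Limits.pushout.inl_desc _ _ _
  have hS' : (ShortComplex.mk (Limits.pushout.inr i f) p' w').ShortExact := by
    refine ShortComplex.ShortExact.mk' ?_ inferInstance ?_
    · apply ShortComplex.exact_of_g_is_cokernel
      refine Limits.CokernelCofork.IsColimit.ofπ _ _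
        (fun {Z} g hg => hS.gIsCokernel.desc (Limits.CokernelCofork.ofπ
          (Limits.pushout.inl i f ≫ g) ?_)) ?_ ?_
      · show i ≫ Limits.pushout.inl i f ≫ g = 0
        rw [← Category.assoc, Limits.pushout.condition, Category.assoc, hg, Limits.comp_zero]
      · intro Z g hg
        apply Limits.pushout.hom_ext
        · rw [← Category.assoc, hp']
          exact hS.gIsCokernel.fac (Limits.CokernelCofork.ofπ _ _) Limits.WalkingParallelPair.one
        · rw [← Category.assoc, w', Limits.zero_comp]; exact hg.symm
      · intro Z g hg m hm
        rw [← cancel_epi p]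
        have := hS.gIsCokernel.fac (Limits.CokernelCofork.ofπ
          (Limits.pushout.inl i f ≫ g) (by
            show i ≫ Limits.pushout.inl i f ≫ g = 0
            rw [← Category.assoc, Limits.pushout.condition, Category.assoc, hg, Limits.comp_zero]))
              Limits.WalkingParallelPair.one
        refine Eq.trans ?_ this.symm
        show p ≫ m = Limits.pushout.inl i f ≫ g
        rw [← hm, ← Category.assoc, hp']
    · exact epi_of_epi_fac hp'
  obtain ⟨s, hs⟩ := h _ _ _ w' hS'
  let φ : ShortComplex.mk i p w ⟶ ShortComplex.mk (Limits.pushout.inr i f) p' w' :=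
    { τ₁ := f, τ₂ := Limits.pushout.inl i f, τ₃ := 𝟙 X
      comm₁₂ := Limits.pushout.condition.symm
      comm₂₃ := by simp [hp'] }
  have h1 := ShortComplex.ShortExact.extClass_naturality hS hS' φ
  simp only [φ] at h1
  rw [hf] at h1
  rw [h1, ← hs, ← Ext.mk₀_comp_mk₀, Ext.comp_assoc (a₂₃ := 1) _ _ _ _ _ (by omega)]
  rw [hS'.comp_extClass, Ext.comp_zero]
  rfl

end basic
end ExcSeq

open CategoryTheory
open Abelian
namespace ExcSeq

section qual
variable {A : Type u} [Ring A]

theorem ext_two (hA : Hereditary A) (X Y : ModuleCat.{u} A) (e : Ext X Y 2) : e = 0 := by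
  obtain ⟨S, P, i, p, hP, w, hS⟩ := exists_proj X
  have : Mono i := hS.mono_f
  have hSP : Projective S := by
    have h := hA P hP (LinearMap.range i.hom)
    have e : S ≅ ModuleCat.of A (LinearMap.range i.hom) :=
      (LinearEquiv.ofInjective i.hom ((ModuleCat.mono_iff_injective i).1 this)).toModuleIso
    exact Projective.of_iso e.symm h
  obtain ⟨f, hf⟩ := Ext.contravariant_sequence_exact₃ hS (Y := Y) e
    (Ext.eq_zero_of_projective _) (n₀ := 1) (by norm_num)
  rw [← hf]
  have : f = 0 := Ext.eq_zero_of_projective (P := S) f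
  rw [this, Ext.comp_zero]

variable {X Y Z : ModuleCat.{u} A} {i : X ⟶ Y} {p : Y ⟶ Z} (h : SE i p) (F : ModuleCat.{u} A)
include h

-- covariant
theorem SE.cov_h1 (h2 : homZero F Y) : homZero F X := fun f => by
  have := h.mono
  rw [← cancel_mono i, h2 (f ≫ i), Limits.zero_comp]

theorem SE.cov_h2 (h1 : homZero F X) (h3 : homZero F Z) : homZero F Y := by
  rw [homZero_iff] at *
  intro e
  obtain ⟨w, hS⟩ := h
  obtain ⟨x, hx⟩ := Ext.covariant_sequence_exact₂ F hS e (h3 _)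
  rw [← hx]; exact (congrArg (fun t => Ext.comp t _ _) (h1 x)).trans (Ext.zero_comp _ _ _ _ _)

theorem SE.cov_h3 (h2 : homZero F Y) (h1 : extZero F X) : homZero F Z := by
  rw [homZero_iff] at *
  rw [extZero_iff] at h1
  intro e
  obtain ⟨w, hS⟩ := h
  obtain ⟨x, hx⟩ := Ext.covariant_sequence_exact₃ F hS e (zero_add 1) (h1 _)
  rw [← hx]; exact (congrArg (fun t => Ext.comp t _ _) (h2 x)).trans (Ext.zero_comp _ _ _ _ _)

theorem SE.cov_e1 (h3 : homZero F Z) (h2 : extZero F Y) : extZero F X := by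
  rw [homZero_iff] at *
  rw [extZero_iff] at *
  intro e
  obtain ⟨w, hS⟩ := h
  obtain ⟨x, hx⟩ := Ext.covariant_sequence_exact₁ F hS e (h2 _) (zero_add 1)
  rw [← hx]; exact (congrArg (fun t => Ext.comp t _ _) (h3 x)).trans (Ext.zero_comp _ _ _ _ _)

theorem SE.cov_e2 (h1 : extZero F X) (h3 : extZero F Z) : extZero F Y := by
  rw [extZero_iff] at *
  intro e
  obtain ⟨w, hS⟩ := h
  obtain ⟨x, hx⟩ := Ext.covariant_sequence_exact₂ F hS e (h3 _)
  rw [← hx]; exact (congrArg (fun t => Ext.comp t _ _) (h1 x)).trans (Ext.zero_comp _ _ _ _ _)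

theorem SE.cov_e3 (hA : Hereditary A) (h2 : extZero F Y) : extZero F Z := by
  rw [extZero_iff] at *
  intro e
  obtain ⟨w, hS⟩ := h
  obtain ⟨x, hx⟩ := Ext.covariant_sequence_exact₃ F hS e (n₁ := 2) rfl (ext_two hA _ _ _)
  rw [← hx]; exact (congrArg (fun t => Ext.comp t _ _) (h2 x)).trans (Ext.zero_comp _ _ _ _ _)

-- contravariant
theorem SE.con_h3 (h2 : homZero Y F) : homZero Z F := fun f => by
  have := h.epi
  rw [← cancel_epi p, h2 (p ≫ f), Limits.comp_zero]

theorem SE.con_h2 (h1 : homZero X F) (h3 : homZero Z F) : homZero Y F := by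
  rw [homZero_iff] at *
  intro e
  obtain ⟨w, hS⟩ := h
  obtain ⟨x, hx⟩ := Ext.contravariant_sequence_exact₂ hS F e (h1 _)
  rw [← hx]; exact (congrArg (fun t => Ext.comp _ t _) (h3 x)).trans (Ext.comp_zero _ _ _ _ _)

theorem SE.con_h1 (h2 : homZero Y F) (h3 : extZero Z F) : homZero X F := by
  rw [homZero_iff] at *
  rw [extZero_iff] at h3
  intro e
  obtain ⟨w, hS⟩ := h
  obtain ⟨x, hx⟩ := Ext.contravariant_sequence_exact₁ hS F e (add_zero 1) (h3 _)
  rw [← hx]; exact (congrArg (fun t => Ext.comp _ t _) (h2 x)).trans (Ext.comp_zero _ _ _ _ _)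

theorem SE.con_e3 (h1 : homZero X F) (h2 : extZero Y F) : extZero Z F := by
  rw [homZero_iff] at *
  rw [extZero_iff] at *
  intro e
  obtain ⟨w, hS⟩ := h
  obtain ⟨x, hx⟩ := Ext.contravariant_sequence_exact₃ hS F e (h2 _) (add_zero 1)
  rw [← hx]; exact (congrArg (fun t => Ext.comp _ t _) (h1 x)).trans (Ext.comp_zero _ _ _ _ _)

theorem SE.con_e2 (h1 : extZero X F) (h3 : extZero Z F) : extZero Y F := by
  rw [extZero_iff] at *
  intro e
  obtain ⟨w, hS⟩ := h
  obtain ⟨x, hx⟩ := Ext.contravariant_sequence_exact₂ hS F e (h1 _)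
  rw [← hx]; exact (congrArg (fun t => Ext.comp _ t _) (h3 x)).trans (Ext.comp_zero _ _ _ _ _)

theorem SE.con_e1 (hA : Hereditary A) (h2 : extZero Y F) : extZero X F := by
  rw [extZero_iff] at *
  intro e
  obtain ⟨w, hS⟩ := h
  obtain ⟨x, hx⟩ := Ext.contravariant_sequence_exact₁ hS F e (n₁ := 2) rfl (ext_two hA _ _ _)
  rw [← hx]; exact (congrArg (fun t => Ext.comp _ t _) (h2 x)).trans (Ext.comp_zero _ _ _ _ _)

end qual

section iso
variable {A : Type u} [Ring A]

theorem homZero.of_retract {X X' Y Y' : ModuleCat.{u} A} (h : homZero X Y) (r : Retract X' X)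
    (r' : Retract Y' Y) : homZero X' Y' := fun f => by
  have := h (r.r ≫ f ≫ r'.i)
  calc f = r.i ≫ (r.r ≫ f ≫ r'.i) ≫ r'.r := by simp
    _ = 0 := by rw [this]; simp

theorem extZero.of_retract {X X' Y Y' : ModuleCat.{u} A} (h : extZero X Y) (r : Retract X' X)
    (r' : Retract Y' Y) : extZero X' Y' := by
  rw [extZero_iff] at *
  intro e
  have h1 := h ((Ext.mk₀ r.r).comp (e.comp (Ext.mk₀ r'.i) (add_zero 1)) (zero_add 1))
  have h2 : (Ext.mk₀ r.i).comp (((Ext.mk₀ r.r).comp (e.comp (Ext.mk₀ r'.i) (add_zero 1))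
    (zero_add 1)).comp (Ext.mk₀ r'.r) (add_zero 1)) (zero_add 1) = e := by
    rw [Ext.comp_assoc (a₂₃ := 1) _ _ _ _ _ (by omega)]
    rw [Ext.comp_assoc (a₂₃ := 0) e _ _ _ (by omega) (by omega)]
    · simp
    · rfl
  rw [← h2, h1]; simp

theorem rperp.of_retract {X X' Y Y' : ModuleCat.{u} A} (h : rperp X Y) (r : Retract X' X)
    (r' : Retract Y' Y) : rperp X' Y' := ⟨h.1.of_retract r r', h.2.of_retract r r'⟩

theorem extZero_of_projective {P : ModuleCat.{u} A} (hP : Projective P) (Y : ModuleCat.{u} A) :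
    extZero P Y := (extZero_iff _ _).2 fun _ => Ext.eq_zero_of_projective _

theorem extZero_of_injective {I : ModuleCat.{u} A} (hI : Injective I) (Y : ModuleCat.{u} A) :
    extZero Y I := (extZero_iff _ _).2 fun _ => Ext.eq_zero_of_injective _

theorem projective_of_extZero {P : ModuleCat.{u} A} (h : ∀ Y, extZero P Y) : Projective P := by
  rw [projective_iff_subsingleton_ext_one]
  intro Y
  exact ⟨fun a b => by rw [(extZero_iff _ _).1 (h Y) a, (extZero_iff _ _).1 (h Y) b]⟩

theorem SE.lift {X Y Z : ModuleCat.{u} A} {i : X ⟶ Y} {p : Y ⟶ Z} (h : SE i p)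
    {F : ModuleCat.{u} A} (hF : extZero F X) (f : F ⟶ Z) : ∃ g : F ⟶ Y, g ≫ p = f := by
  obtain ⟨w, hS⟩ := h
  obtain ⟨x, hx⟩ := Ext.covariant_sequence_exact₃ F hS (Ext.mk₀ f) (zero_add 1)
    ((extZero_iff _ _).1 hF _)
  obtain ⟨s, rfl⟩ := (Ext.mk₀_bijective _ _).2 x
  exact ⟨s, (Ext.mk₀_bijective _ _).1 (by simpa using hx)⟩

theorem SE.desc {X Y Z : ModuleCat.{u} A} {i : X ⟶ Y} {p : Y ⟶ Z} (h : SE i p)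
    {F : ModuleCat.{u} A} (hF : extZero Z F) (f : X ⟶ F) : ∃ g : Y ⟶ F, i ≫ g = f := by
  obtain ⟨w, hS⟩ := h
  obtain ⟨x, hx⟩ := Ext.contravariant_sequence_exact₁ hS F (Ext.mk₀ f) (add_zero 1)
    ((extZero_iff _ _).1 hF _)
  obtain ⟨s, rfl⟩ := (Ext.mk₀_bijective _ _).2 x
  exact ⟨s, (Ext.mk₀_bijective _ _).1 (by simpa using hx)⟩

end iso
end ExcSeq

open CategoryTheory
open Abelian
namespace ExcSeq
set_option linter.unusedSectionVars false

/-- finitely generated -/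
def FD {A : Type u} [Ring A] (X : ModuleCat.{u} A) : Prop := Module.Finite A X

section num
variable (K : Type u) [Field K] {A : Type u} [Ring A] [Algebra K A]

/-- dim of Hom -/
noncomputable def hh (X Y : ModuleCat.{u} A) : ℕ := Module.finrank K (Ext X Y 0)
/-- dim of Ext1 -/
noncomputable def ee (X Y : ModuleCat.{u} A) : ℕ := Module.finrank K (Ext X Y 1)
/-- Euler form -/
noncomputable def chi (X Y : ModuleCat.{u} A) : ℚ := (hh K X Y : ℚ) - ee K X Y

variable [FiniteDimensional K A]
include K

theorem SE.fd1 {X Y Z : ModuleCat.{u} A} {i : X ⟶ Y} {p : Y ⟶ Z} (h : SE i p) (hY : FD Y) :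
    FD X := by
  have : IsNoetherianRing A := IsNoetherianRing.of_finite K A
  have : Module.Finite A Y := hY
  exact Module.Finite.of_injective i.hom ((ModuleCat.mono_iff_injective i).1 h.mono)

omit [FiniteDimensional K A] in
theorem SE.fd3 {X Y Z : ModuleCat.{u} A} {i : X ⟶ Y} {p : Y ⟶ Z} (h : SE i p) (hY : FD Y) :
    FD Z := by
  have : Module.Finite A Y := hY
  exact Module.Finite.of_surjective p.hom ((ModuleCat.epi_iff_surjective p).1 h.epi)

theorem SE.fd2 {X Y Z : ModuleCat.{u} A} {i : X ⟶ Y} {p : Y ⟶ Z} (h : SE i p) (hX : FD X)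
    (hZ : FD Z) : FD Y := by
  have : Module.Finite A X := hX
  have : Module.Finite A Z := hZ
  have hex : Function.Exact i.hom p.hom := by
    obtain ⟨w, hS⟩ := h
    exact (ShortComplex.ShortExact.moduleCat_exact_iff_function_exact _).1 hS.exact
  have : Module.Finite A (LinearMap.range i.hom) := inferInstance
  have hr : LinearMap.ker p.hom = LinearMap.range i.hom := LinearMap.exact_iff.1 hex
  have : (LinearMap.ker p.hom).FG := by rw [hr]; exact Module.Finite.iff_fg.1 this
  refine ⟨Submodule.fg_of_fg_map_of_fg_inf_ker p.hom (s := ⊤) ?_ (by simpa using this)⟩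
  rw [Submodule.map_top, LinearMap.range_eq_top.2 ((ModuleCat.epi_iff_surjective p).1 h.epi)]
  exact Module.Finite.fg_top

open ModuleCat in
theorem fin0 {X Y : ModuleCat.{u} A} (hX : FD X) (hY : FD Y) : Module.Finite K (Ext X Y 0) := by
  have : Module.Finite A X := hX
  have : Module.Finite A Y := hY
  have : Module.Finite K X := Module.Finite.trans A X
  have : Module.Finite K Y := Module.Finite.trans A Y
  let φ : (X ⟶ Y) →ₗ[K] (X →ₗ[K] Y) :=
    { toFun := fun f => f.hom.restrictScalars K
      map_add' := fun f g => rfl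
      map_smul' := fun r f => rfl }
  have hφ : Function.Injective φ := by
    intro f g hfg
    ext x
    exact LinearMap.congr_fun hfg x
  have : Module.Finite K (X ⟶ Y) := Module.Finite.of_injective φ hφ
  exact Module.Finite.equiv (Ext.linearEquiv₀ (R := K) (X := X) (Y := Y)).symm

theorem exists_proj_fd {X : ModuleCat.{u} A} (hX : FD X) :
    ∃ (S P : ModuleCat.{u} A) (i : S ⟶ P) (p : P ⟶ X), Projective P ∧ FD P ∧ SE i p := by
  have : Module.Finite A X := hX
  obtain ⟨n, f, hf⟩ := Module.Finite.exists_fin' A X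
  let p : ModuleCat.of A (ULift.{u} (Fin n) →₀ A) ⟶ X := ModuleCat.ofHom
    (f ∘ₗ (Finsupp.linearEquivFunOnFinite A A (Fin n)).toLinearMap ∘ₗ
      (Finsupp.domLCongr Equiv.ulift).toLinearMap)
  have : Epi p := by
    rw [ModuleCat.epi_iff_surjective]
    simpa [p] using hf
  exact ⟨_, _, _, p, ModuleCat.projective_of_free (Finsupp.basisSingleOne),
    (inferInstance : Module.Finite A (ULift.{u} (Fin n) →₀ A)), SE.of_epi p⟩

theorem fin1 {X Y : ModuleCat.{u} A} (hX : FD X) (hY : FD Y) : Module.Finite K (Ext X Y 1) := by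
  obtain ⟨S, P, i, p, hP, hPf, w, hS⟩ := exists_proj_fd K hX
  have := fin0 K (SE.fd1 K ⟨w, hS⟩ hPf) hY
  refine Module.Finite.of_surjective (hS.extClass.precompOfLinear K Y (add_zero 1)) ?_
  intro e
  obtain ⟨f, hf⟩ := Ext.contravariant_sequence_exact₃ hS (Y := Y) e
    (Ext.eq_zero_of_projective _) (add_zero 1)
  exact ⟨f, hf⟩

omit [FiniteDimensional K A] in
theorem six {V1 V2 V3 V4 V5 V6 : Type*} [AddCommGroup V1] [AddCommGroup V2] [AddCommGroup V3]
    [AddCommGroup V4] [AddCommGroup V5] [AddCommGroup V6] [Module K V1] [Module K V2]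
    [Module K V3] [Module K V4] [Module K V5] [Module K V6] [Module.Finite K V1]
    [Module.Finite K V2] [Module.Finite K V3] [Module.Finite K V4] [Module.Finite K V5]
    [Module.Finite K V6] (f1 : V1 →ₗ[K] V2) (f2 : V2 →ₗ[K] V3) (f3 : V3 →ₗ[K] V4)
    (f4 : V4 →ₗ[K] V5) (f5 : V5 →ₗ[K] V6) (h1 : Function.Injective f1)
    (h2 : Function.Exact f1 f2) (h3 : Function.Exact f2 f3) (h4 : Function.Exact f3 f4)
    (h5 : Function.Exact f4 f5) (h6 : Function.Surjective f5) :
    (Module.finrank K V2 : ℚ) - Module.finrank K V5 =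
      (Module.finrank K V1 - Module.finrank K V4) + (Module.finrank K V3 - Module.finrank K V6) := by
  have e1 := LinearMap.finrank_range_add_finrank_ker f1
  have e2 := LinearMap.finrank_range_add_finrank_ker f2
  have e3 := LinearMap.finrank_range_add_finrank_ker f3
  have e4 := LinearMap.finrank_range_add_finrank_ker f4
  have e5 := LinearMap.finrank_range_add_finrank_ker f5
  rw [LinearMap.ker_eq_bot.2 h1, finrank_bot] at e1
  rw [LinearMap.exact_iff.1 h2] at e2
  rw [LinearMap.exact_iff.1 h3] at e3
  rw [LinearMap.exact_iff.1 h4] at e4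
  rw [LinearMap.exact_iff.1 h5, LinearMap.range_eq_top.2 h6, finrank_top] at e5
  rw [← e1, ← e2, ← e3, ← e4, ← e5]
  push_cast
  ring

variable (hA : Hereditary A)
include hA

theorem chi_cov {X Y Z : ModuleCat.{u} A} {i : X ⟶ Y} {p : Y ⟶ Z} (h : SE i p)
    {F : ModuleCat.{u} A} (hF : FD F) (hX : FD X) (hZ : FD Z) :
    chi K F Y = chi K F X + chi K F Z := by
  have hY := SE.fd2 K h hX hZ
  have hm := h.mono
  obtain ⟨w, hS⟩ := h
  have := fin0 K hF hX
  have := fin0 K hF hY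
  have := fin0 K hF hZ
  have := fin1 K hF hX
  have := fin1 K hF hY
  have := fin1 K hF hZ
  refine six K ((Ext.mk₀ i).postcompOfLinear K F (add_zero 0))
    ((Ext.mk₀ p).postcompOfLinear K F (add_zero 0))
    (hS.extClass.postcompOfLinear K F (zero_add 1))
    ((Ext.mk₀ i).postcompOfLinear K F (add_zero 1))
    ((Ext.mk₀ p).postcompOfLinear K F (add_zero 1)) ?_ ?_ ?_ ?_ ?_ ?_
  · exact Ext.postcomp_mk₀_injective_of_mono F i
  · intro x
    refine ⟨fun hx => Ext.covariant_sequence_exact₂ F hS x hx, ?_⟩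
    rintro ⟨y, rfl⟩
    simp [w]
  · intro x
    refine ⟨fun hx => Ext.covariant_sequence_exact₃ F hS x (zero_add 1) hx, ?_⟩
    rintro ⟨y, rfl⟩
    show Ext.comp (Ext.comp y _ (add_zero 0)) _ (zero_add 1) = 0
    rw [Ext.comp_assoc (a₂₃ := 1) _ _ _ _ _ (by omega), hS.comp_extClass, Ext.comp_zero]
    rfl
  · intro x
    refine ⟨fun hx => Ext.covariant_sequence_exact₁ F hS x hx (zero_add 1), ?_⟩
    rintro ⟨y, rfl⟩
    show Ext.comp (Ext.comp y _ (zero_add 1)) _ (add_zero 1) = 0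
    rw [Ext.comp_assoc (a₂₃ := 1) _ _ _ _ _ (by omega), hS.extClass_comp, Ext.comp_zero]
    rfl
  · intro x
    refine ⟨fun hx => Ext.covariant_sequence_exact₂ F hS x hx, ?_⟩
    rintro ⟨y, rfl⟩
    simp [w]
  · intro x
    exact Ext.covariant_sequence_exact₃ F hS x (n₁ := 2) rfl (ext_two hA _ _ _)

theorem chi_con {X Y Z : ModuleCat.{u} A} {i : X ⟶ Y} {p : Y ⟶ Z} (h : SE i p)
    {F : ModuleCat.{u} A} (hF : FD F) (hX : FD X) (hZ : FD Z) :
    chi K Y F = chi K X F + chi K Z F := by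
  have hY := SE.fd2 K h hX hZ
  have hm := h.epi
  obtain ⟨w, hS⟩ := h
  have := fin0 K hX hF
  have := fin0 K hY hF
  have := fin0 K hZ hF
  have := fin1 K hX hF
  have := fin1 K hY hF
  have := fin1 K hZ hF
  rw [add_comm]
  refine six K ((Ext.mk₀ p).precompOfLinear K F (zero_add 0))
    ((Ext.mk₀ i).precompOfLinear K F (zero_add 0))
    (hS.extClass.precompOfLinear K F (add_zero 1))
    ((Ext.mk₀ p).precompOfLinear K F (zero_add 1))
    ((Ext.mk₀ i).precompOfLinear K F (zero_add 1)) ?_ ?_ ?_ ?_ ?_ ?_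
  · exact Ext.precomp_mk₀_injective_of_epi F p
  · intro x
    refine ⟨fun hx => Ext.contravariant_sequence_exact₂ hS F x hx, ?_⟩
    rintro ⟨y, rfl⟩
    simp [w]
  · intro x
    refine ⟨fun hx => Ext.contravariant_sequence_exact₁ hS F x (add_zero 1) hx, ?_⟩
    rintro ⟨y, rfl⟩
    show Ext.comp _ (Ext.comp _ y (zero_add 0)) (add_zero 1) = 0
    rw [← Ext.comp_assoc (a₁₂ := 1) _ _ _ _ _ (by omega), hS.extClass_comp, Ext.zero_comp]
    rfl
  · intro x
    refine ⟨fun hx => Ext.contravariant_sequence_exact₃ hS F x hx (add_zero 1), ?_⟩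
    rintro ⟨y, rfl⟩
    show Ext.comp _ (Ext.comp _ y (add_zero 1)) (zero_add 1) = 0
    rw [← Ext.comp_assoc (a₁₂ := 1) _ _ _ _ _ (by omega), hS.comp_extClass, Ext.zero_comp]
    rfl
  · intro x
    refine ⟨fun hx => Ext.contravariant_sequence_exact₂ hS F x hx, ?_⟩
    rintro ⟨y, rfl⟩
    simp [w]
  · intro x
    exact Ext.contravariant_sequence_exact₁ hS F x (n₁ := 2) rfl (ext_two hA _ _ _)

end num
end ExcSeq

open CategoryTheory
open Abelian
namespace ExcSeq
set_option linter.unusedSectionVars false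
set_option linter.unusedVariables false

section num2
variable (K : Type u) [Field K] {A : Type u} [Ring A] [Algebra K A]

theorem hh_of_homZero {X Y : ModuleCat.{u} A} (h : homZero X Y) : hh K X Y = 0 := by
  have : Subsingleton (Ext X Y 0) := ⟨fun a b => by
    rw [(homZero_iff X Y).1 h a, (homZero_iff X Y).1 h b]⟩
  exact Module.finrank_zero_of_subsingleton

theorem ee_of_extZero {X Y : ModuleCat.{u} A} (h : extZero X Y) : ee K X Y = 0 := by
  have : Subsingleton (Ext X Y 1) := ⟨fun a b => by
    rw [(extZero_iff X Y).1 h a, (extZero_iff X Y).1 h b]⟩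
  exact Module.finrank_zero_of_subsingleton

theorem chi_of_rperp {X Y : ModuleCat.{u} A} (h : rperp X Y) : chi K X Y = 0 := by
  simp [chi, hh_of_homZero K h.1, ee_of_extZero K h.2]

theorem chi_of_extZero {X Y : ModuleCat.{u} A} (h : extZero X Y) : chi K X Y = hh K X Y := by
  simp [chi, ee_of_extZero K h]

theorem chi_nonneg {X Y : ModuleCat.{u} A} (h : extZero X Y) : 0 ≤ chi K X Y := by
  rw [chi_of_extZero K h]; positivity

variable [FiniteDimensional K A]

theorem hh_eq_zero {X Y : ModuleCat.{u} A} (hX : FD X) (hY : FD Y) :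
    hh K X Y = 0 ↔ homZero X Y := by
  refine ⟨fun h => ?_, hh_of_homZero K⟩
  have := fin0 K hX hY
  have := Module.finrank_zero_iff.1 h
  exact (homZero_iff X Y).2 fun e => Subsingleton.elim _ _

theorem ee_eq_zero {X Y : ModuleCat.{u} A} (hX : FD X) (hY : FD Y) :
    ee K X Y = 0 ↔ extZero X Y := by
  refine ⟨fun h => ?_, ee_of_extZero K⟩
  have := fin1 K hX hY
  have := Module.finrank_zero_iff.1 h
  exact (extZero_iff X Y).2 fun e => Subsingleton.elim _ _

theorem homZero_of_chi {X Y : ModuleCat.{u} A} (hX : FD X) (hY : FD Y) (h : extZero X Y)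
    (h0 : chi K X Y = 0) : homZero X Y := by
  rw [chi_of_extZero K h] at h0
  exact (hh_eq_zero K hX hY).1 (by exact_mod_cast h0)

theorem chi_pos {X Y : ModuleCat.{u} A} (hX : FD X) (hY : FD Y) (h : extZero X Y)
    (h0 : ¬ homZero X Y) : 0 < chi K X Y :=
  lt_of_le_of_ne (chi_nonneg K h) fun h' => h0 (homZero_of_chi K hX hY h h'.symm)

theorem not_homZero_of_chi {X Y : ModuleCat.{u} A} (h0 : 0 < chi K X Y) : ¬ homZero X Y := by
  intro h
  have : chi K X Y ≤ 0 := by simp [chi, hh_of_homZero K h]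
  linarith

omit [Field K] [Algebra K A] [FiniteDimensional K A] in
theorem isZero_iff_homZero {X : ModuleCat.{u} A} : Limits.IsZero X ↔ homZero X X :=
  ⟨fun h f => h.eq_of_src _ _, fun h => (Limits.IsZero.iff_id_eq_zero X).2 (h _)⟩

theorem ExceptionalMod.fd {X : ModuleCat.{u} A} (h : ExceptionalMod X) : FD X := h.1
theorem ExceptionalMod.ext {X : ModuleCat.{u} A} (h : ExceptionalMod X) : extZero X X := h.2.1
theorem ExceptionalMod.nz {X : ModuleCat.{u} A} (h : ExceptionalMod X) : ¬ Limits.IsZero X := by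
  intro h0
  have := h.2.2.1
  have := ModuleCat.subsingleton_of_isZero h0
  exact not_subsingleton X this
theorem ExceptionalMod.iso {X : ModuleCat.{u} A} (h : ExceptionalMod X) (f : X ⟶ X)
    (hf : f ≠ 0) : IsIso f := h.2.2.2 f hf

theorem ExceptionalMod.mk' {X : ModuleCat.{u} A} (h1 : FD X) (h2 : extZero X X)
    (h3 : ¬ Limits.IsZero X) (h4 : ∀ f : X ⟶ X, f ≠ 0 → IsIso f) : ExceptionalMod X := by
  refine ⟨h1, h2, ?_, h4⟩
  rw [← not_subsingleton_iff_nontrivial]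
  exact fun h => h3 (ModuleCat.isZero_of_subsingleton X)

theorem ExceptionalMod.of_iso {X Y : ModuleCat.{u} A} (h : ExceptionalMod X) (e : X ≅ Y) :
    ExceptionalMod Y := by
  refine ExceptionalMod.mk' ?_ (h.ext.of_retract ⟨e.inv, e.hom, by simp⟩ ⟨e.inv, e.hom, by simp⟩)
    (fun h0 => h.nz (h0.of_iso e)) ?_
  · have : Module.Finite A X := h.fd
    exact Module.Finite.equiv e.toLinearEquiv
  · intro f hf
    have := h.iso (e.hom ≫ f ≫ e.inv) (by
      intro h0
      apply hf
      have : e.inv ≫ (e.hom ≫ f ≫ e.inv) ≫ e.hom = 0 := by rw [h0]; simp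
      simpa using this)
    have h2 : f = e.inv ≫ (e.hom ≫ f ≫ e.inv) ≫ e.hom := by simp
    rw [h2]; infer_instance

theorem chi_self {X : ModuleCat.{u} A} (h : ExceptionalMod X) : 0 < chi K X X :=
  chi_pos K h.fd h.fd h.ext fun h0 => h.nz (isZero_iff_homZero.2 h0)

/-- the regular module -/
abbrev regA (A : Type u) [Ring A] : ModuleCat.{u} A := ModuleCat.of A A

theorem regA_fd : FD (regA A) := (inferInstance : Module.Finite A A)
theorem regA_proj : Projective (regA A) := ModuleCat.projective_of_free (Module.Basis.singleton PUnit.{u+1} A)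

theorem isZero_iff_regA {X : ModuleCat.{u} A} : Limits.IsZero X ↔ homZero (regA A) X := by
  refine ⟨fun h f => h.eq_of_tgt _ _, fun h => ?_⟩
  have : Subsingleton X := by
    refine subsingleton_of_forall_eq 0 fun x => ?_
    have := h (ModuleCat.ofHom (LinearMap.toSpanSingleton A X x))
    have := congrArg (fun f => f.hom (1 : A)) this
    simpa using this
  exact ModuleCat.isZero_of_subsingleton X

/-- dimension -/
noncomputable def dm (M : ModuleCat.{u} A) : ℕ := hh K (regA A) M

theorem dm_chi (M : ModuleCat.{u} A) : chi K (regA A) M = dm K M :=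
  chi_of_extZero K (extZero_of_projective regA_proj _)

theorem dm_zero {M : ModuleCat.{u} A} (h : FD M) : dm K M = 0 ↔ Limits.IsZero M := by
  rw [isZero_iff_regA, dm, hh_eq_zero K regA_fd h]

theorem dm_pos {M : ModuleCat.{u} A} (h : FD M) (h0 : ¬ Limits.IsZero M) : 0 < dm K M :=
  Nat.pos_of_ne_zero fun h' => h0 ((dm_zero K h).1 h')

/-- the space of dimension vectors -/
abbrev VV (A : Type u) [Ring A] : Type (u+1) :=
  ({X : ModuleCat.{u} A // FD X} → ℚ) × ({X : ModuleCat.{u} A // FD X} → ℚ)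

/-- class -/
noncomputable def d (M : ModuleCat.{u} A) : VV A :=
  (fun X => chi K X.1 M, fun X => chi K M X.1)
/-- left functional -/
def lf {X : ModuleCat.{u} A} (hX : FD X) : VV A →ₗ[ℚ] ℚ :=
  (LinearMap.proj (⟨X, hX⟩ : {X : ModuleCat.{u} A // FD X})).comp (LinearMap.fst ℚ _ _)
/-- right functional -/
def rf {X : ModuleCat.{u} A} (hX : FD X) : VV A →ₗ[ℚ] ℚ :=
  (LinearMap.proj (⟨X, hX⟩ : {X : ModuleCat.{u} A // FD X})).comp (LinearMap.snd ℚ _ _)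

theorem lf_d {X : ModuleCat.{u} A} (hX : FD X) (M : ModuleCat.{u} A) :
    lf hX (d K M) = chi K X M := rfl
theorem rf_d {X : ModuleCat.{u} A} (hX : FD X) (M : ModuleCat.{u} A) :
    rf hX (d K M) = chi K M X := rfl

theorem d_eq_iff {M N : ModuleCat.{u} A} : d K M = d K N ↔
    ∀ X : ModuleCat.{u} A, FD X → chi K X M = chi K X N ∧ chi K M X = chi K N X := by
  refine ⟨fun h X hX => ⟨?_, ?_⟩, fun h => ?_⟩
  · rw [← lf_d K hX, ← lf_d K hX, h]
  · rw [← rf_d K hX, ← rf_d K hX, h]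
  · exact Prod.ext (funext fun X => (h X.1 X.2).1) (funext fun X => (h X.1 X.2).2)

variable (hA : Hereditary A)
include hA

section
variable {X Y Z : ModuleCat.{u} A} {i : X ⟶ Y} {p : Y ⟶ Z}

theorem d_add (h : SE i p) (hX : FD X) (hZ : FD Z) : d K Y = d K X + d K Z :=
  Prod.ext (funext fun F => chi_cov K hA h F.2 hX hZ) (funext fun F => chi_con K hA h F.2 hX hZ)

theorem dm_add (h : SE i p) (hY : FD Y) : dm K Y = dm K X + dm K Z := by
  have := chi_cov K hA h regA_fd (h.fd1 K hY) (h.fd3 K hY)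
  simp only [dm_chi] at this
  exact_mod_cast this

theorem dm_add' (h : SE i p) (hX : FD X) (hZ : FD Z) : dm K Y = dm K X + dm K Z := 
  dm_add K hA h (h.fd2 K hX hZ)

theorem isIso_of_mono (f : X ⟶ Y) [Mono f] (hY : FD Y) (h : dm K Y ≤ dm K X) : IsIso f := by
  have h1 := SE.of_mono f
  have h2 := dm_add K hA h1 hY
  have : Limits.IsZero _ := (dm_zero K (h1.fd3 K hY)).1 (by omega)
  have : Epi f := Preadditive.epi_of_cokernel_zero (this.eq_of_tgt _ _)
  exact isIso_of_mono_of_epi f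

theorem isIso_of_epi (f : X ⟶ Y) [Epi f] (hX : FD X) (h : dm K X ≤ dm K Y) : IsIso f := by
  have h1 := SE.of_epi f
  have h2 := dm_add K hA h1 hX
  have : Limits.IsZero _ := (dm_zero K (h1.fd1 K hX)).1 (by omega)
  have : Mono f := Preadditive.mono_of_kernel_zero (this.eq_of_src _ _)
  exact isIso_of_mono_of_epi f

end

omit hA in
theorem SE.idz (X : ModuleCat.{u} A) : ∃ (Z : ModuleCat.{u} A) (p : X ⟶ Z), SE (𝟙 X) p :=
  ⟨_, _, SE.of_mono _⟩

omit hA in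
theorem SE.zid (X : ModuleCat.{u} A) : ∃ (Z : ModuleCat.{u} A) (p : Z ⟶ X), SE p (𝟙 X) :=
  ⟨_, _, SE.of_epi _⟩

/-- d is iso invariant -/
theorem d_iso {X Y : ModuleCat.{u} A} (e : X ≅ Y) (hX : FD X) : d K X = d K Y := by
  have h1 := SE.of_mono e.hom
  have hY : FD Y := by
    have : Module.Finite A X := hX
    exact Module.Finite.equiv e.toLinearEquiv
  have hz : FD (Limits.cokernel e.hom) := h1.fd3 K hY
  have h2 := d_add K hA h1 hX hz
  have h3 := SE.of_mono (𝟙 (Limits.cokernel e.hom))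
  have hz' := h3.fd3 K hz
  have h4 := d_add K hA h3 hz hz'
  have e0 : Limits.IsZero (Limits.cokernel e.hom) := by
    rw [Limits.IsZero.iff_id_eq_zero, ← cancel_epi (Limits.cokernel.π e.hom)]
    rw [show Limits.cokernel.π e.hom = 0 from Limits.cokernel.π_of_epi e.hom]; simp
  have : d K (Limits.cokernel e.hom) = 0 := by
    refine Prod.ext (funext fun F => chi_of_rperp K ⟨fun f => e0.eq_of_tgt _ _, ?_⟩)
      (funext fun F => chi_of_rperp K ⟨fun f => e0.eq_of_src _ _, ?_⟩)
    · rintro E i p w hS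
      have := hS.epi_g
      have := hS.mono_f
      have : Mono p := by
        refine Preadditive.mono_of_cancel_zero _ fun g hg => ?_
        obtain ⟨l, hl⟩ := hS.exact.lift' g hg
        rw [← hl, e0.eq_of_tgt l 0]; simp
      have : IsIso p := isIso_of_mono_of_epi p
      exact ⟨inv p, by simp⟩
    · rintro E i p w hS
      exact ⟨0, e0.eq_of_src _ _⟩
  rw [h2, this, add_zero]

end num2

section wide
variable {A : Type u} [Ring A]

/-- wide subcategories -/
structure IsWide (W : ModuleCat.{u} A → Prop) : Prop where
  ext : ∀ {X Y Z : ModuleCat.{u} A} {i : X ⟶ Y} {p : Y ⟶ Z}, SE i p → W X → W Z → W Y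
  fac : ∀ {N X I Y Q : ModuleCat.{u} A} {ι : N ⟶ X} {p : X ⟶ I} {i : I ⟶ Y} {π : Y ⟶ Q},
    SE ι p → SE i π → W X → W Y → W N ∧ W I ∧ W Q

theorem IsWide.ker {W : ModuleCat.{u} A → Prop} (hW : IsWide W) {X Y Z : ModuleCat.{u} A}
    {i : X ⟶ Y} {p : Y ⟶ Z} (h : SE i p) (hY : W Y) (hZ : W Z) : W X := by
  obtain ⟨Q, π, h'⟩ := SE.idz Z
  exact (hW.fac h h' hY hZ).1

theorem IsWide.coker {W : ModuleCat.{u} A → Prop} (hW : IsWide W) {X Y Z : ModuleCat.{u} A}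
    {i : X ⟶ Y} {p : Y ⟶ Z} (h : SE i p) (hX : W X) (hY : W Y) : W Z := by
  obtain ⟨Q, π, h'⟩ := SE.zid X
  exact (hW.fac h' h hX hY).2.2

theorem IsWide.iso {W : ModuleCat.{u} A → Prop} (hW : IsWide W) {X Y : ModuleCat.{u} A}
    (e : X ≅ Y) (hX : W X) : W Y :=
  (hW.fac (SE.of_epi e.hom) (SE.of_mono e.inv) hX hX).2.1

theorem IsWide.true : IsWide (fun _ : ModuleCat.{u} A => True) := ⟨fun _ _ _ => trivial,
  fun _ _ _ _ => ⟨trivial, trivial, trivial⟩⟩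

theorem IsWide.and {W V : ModuleCat.{u} A → Prop} (hW : IsWide W) (hV : IsWide V) :
    IsWide (fun X => W X ∧ V X) :=
  ⟨fun h hX hZ => ⟨hW.ext h hX.1 hZ.1, hV.ext h hX.2 hZ.2⟩, fun h h' hX hY =>
    ⟨⟨(hW.fac h h' hX.1 hY.1).1, (hV.fac h h' hX.2 hY.2).1⟩,
     ⟨(hW.fac h h' hX.1 hY.1).2.1, (hV.fac h h' hX.2 hY.2).2.1⟩,
     ⟨(hW.fac h h' hX.1 hY.1).2.2, (hV.fac h h' hX.2 hY.2).2.2⟩⟩⟩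

theorem IsWide.all {ι : Sort*} {W : ι → ModuleCat.{u} A → Prop} (hW : ∀ a, IsWide (W a)) :
    IsWide (fun X => ∀ a, W a X) :=
  ⟨fun h hX hZ a => (hW a).ext h (hX a) (hZ a), fun h h' hX hY =>
    ⟨fun a => ((hW a).fac h h' (hX a) (hY a)).1, fun a => ((hW a).fac h h' (hX a) (hY a)).2.1,
     fun a => ((hW a).fac h h' (hX a) (hY a)).2.2⟩⟩

theorem IsWide.imp {c : Prop} {W : ModuleCat.{u} A → Prop} (hW : IsWide W) :
    IsWide (fun X => c → W X) := IsWide.all fun _ => hW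

variable (hA : Hereditary A)
include hA

theorem wide_r (F : ModuleCat.{u} A) : IsWide (fun Y => rperp F Y) := by
  refine ⟨fun h hX hZ => ⟨h.cov_h2 F hX.1 hZ.1, h.cov_e2 F hX.2 hZ.2⟩, ?_⟩
  intro N X I Y Q ι p i π h1 h2 hX hY
  have hI : rperp F I := ⟨h2.cov_h1 F hY.1, h1.cov_e3 F hA hX.2⟩
  exact ⟨⟨h1.cov_h1 F hX.1, h1.cov_e1 F hI.1 hX.2⟩, hI, 
    ⟨h2.cov_h3 F hY.1 hI.2, h2.cov_e3 F hA hY.2⟩⟩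

theorem wide_l (G : ModuleCat.{u} A) : IsWide (fun Y => rperp Y G) := by
  refine ⟨fun h hX hZ => ⟨h.con_h2 G hX.1 hZ.1, h.con_e2 G hX.2 hZ.2⟩, ?_⟩
  intro N X I Y Q ι p i π h1 h2 hX hY
  have hI : rperp I G := ⟨h1.con_h3 G hX.1, h2.con_e1 G hA hY.2⟩
  exact ⟨⟨h1.con_h1 G hX.1 hI.2, h1.con_e1 G hA hX.2⟩, hI, 
    ⟨h2.con_h3 G hY.1, h2.con_e3 G hI.1 hY.2⟩⟩

end wide
end ExcSeq

open CategoryTheory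
open Abelian
namespace ExcSeq
set_option linter.unusedSectionVars false
set_option linter.unusedVariables false

section red0
variable {A : Type u} [Ring A]

theorem univ_step {F M : ModuleCat.{u} A} (hF : ExceptionalMod F) (h0 : homZero F M)
    (h1 : ¬ extZero F M) : ∃ (M' : ModuleCat.{u} A) (i : M ⟶ M') (p : M' ⟶ F), SE i p ∧
      homZero F M' := by
  unfold extZero at h1
  push Not at h1
  obtain ⟨E, i, p, w, hS, hs⟩ := h1
  refine ⟨E, i, p, ⟨w, hS⟩, fun g => ?_⟩
  by_cases hg : g ≫ p = 0
  · have := hS.mono_f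
    obtain ⟨l, hl⟩ := hS.exact.lift' g hg
    rw [← hl, h0 l, Limits.zero_comp]
  · have := hF.iso _ hg
    exact absurd (by rw [Category.assoc]; exact IsIso.inv_hom_id _) (hs (inv (g ≫ p) ≫ g))

theorem couniv_step {F M : ModuleCat.{u} A} (hF : ExceptionalMod F) (h0 : homZero M F)
    (h1 : ¬ extZero M F) : ∃ (M' : ModuleCat.{u} A) (i : F ⟶ M') (p : M' ⟶ M), SE i p ∧
      homZero M' F := by
  unfold extZero at h1
  push Not at h1
  obtain ⟨E, i, p, w, hS, hs⟩ := h1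
  refine ⟨E, i, p, ⟨w, hS⟩, fun g => ?_⟩
  have := hS.epi_g
  by_cases hg : i ≫ g = 0
  · obtain ⟨l, hl⟩ := hS.exact.desc' g hg
    rw [← hl, h0 l, Limits.comp_zero]
  · have := hF.iso _ hg
    let sp := ShortComplex.Splitting.ofExactOfRetraction _ hS.exact (g ≫ inv (i ≫ g))
      (by rw [← Category.assoc]; exact IsIso.hom_inv_id _) hS.epi_g
    exact absurd sp.s_g (hs sp.s)

theorem factor_nz {N X I Y Q : ModuleCat.{u} A} {ι : N ⟶ X} {p : X ⟶ I} {i : I ⟶ Y} {f : X ⟶ Y}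
    (h : p ≫ i = f) (hf : f ≠ 0) : ¬ Limits.IsZero I := fun h0 => hf (by
  rw [← h, h0.eq_of_src i 0, Limits.comp_zero])

/-- exceptional collection on a finset -/
def ExcOn {Ω : Type*} [LinearOrder Ω] (E : Ω → ModuleCat.{u} A) (T : Finset Ω) : Prop :=
  (∀ u ∈ T, ExceptionalMod (E u)) ∧ ∀ u ∈ T, ∀ v ∈ T, u < v → rperp (E v) (E u)

theorem ExcOn.mono {Ω : Type*} [LinearOrder Ω] {E : Ω → ModuleCat.{u} A} {T S : Finset Ω}
    (h : ExcOn E T) (hs : S ⊆ T) : ExcOn E S :=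
  ⟨fun u hu => h.1 u (hs hu), fun u hu v hv => h.2 u (hs hu) v (hs hv)⟩

end red0

section red
variable (K : Type u) [Field K] {A : Type u} [Ring A] [Algebra K A] [FiniteDimensional K A]
  (hA : Hereditary A)
include hA

/-- span of classes -/
noncomputable def Sp (W : ModuleCat.{u} A → Prop) : Submodule ℚ (VV A) :=
  Submodule.span ℚ (d K '' {N | FD N ∧ W N})

include K in
theorem red1 {W : ModuleCat.{u} A → Prop} (hW : IsWide W) {F : ModuleCat.{u} A}
    (hF : ExceptionalMod F) (hWF : W F) (M : ModuleCat.{u} A) (hM : FD M) (hWM : W M)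
    (h0 : homZero F M) : ∃ M' : ModuleCat.{u} A, FD M' ∧ W M' ∧ rperp F M' ∧
      (∃ e : ℚ, d K M' = d K M + e • d K F) ∧ ∀ Y, rperp F Y →
        (extZero M Y → extZero M' Y) ∧ (homZero M' Y → homZero M Y) := by
  induction hn : ee K F M using Nat.strong_induction_on generalizing M with
  | _ n ih =>
  by_cases h1 : extZero F M
  · exact ⟨M, hM, hWM, ⟨h0, h1⟩, ⟨0, by simp⟩, fun Y _ => ⟨id, id⟩⟩
  · obtain ⟨M1, i, p, hS, h01⟩ := univ_step hF h0 h1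
    have hc := chi_cov K hA hS hF.fd hM hF.fd
    have hp := chi_self K hF
    have hlt : ee K F M1 < n := by
      have : (ee K F M1 : ℚ) < ee K F M := by
        simp only [chi, hh_of_homZero K h0, hh_of_homZero K h01] at hc hp
        push_cast at hc
        linarith
      rw [← hn]
      exact_mod_cast this
    obtain ⟨M', a1, a2, a3, ⟨e, a4⟩, a5⟩ := ih _ hlt M1 (hS.fd2 K hM hF.fd) (hW.ext hS hWM hWF)
      h01 rfl
    refine ⟨M', a1, a2, a3, ⟨e + 1, ?_⟩, fun Y hY => ⟨fun h => ?_, fun h => ?_⟩⟩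
    · rw [a4, d_add K hA hS hM hF.fd]
      module
    · exact (a5 Y hY).1 (hS.con_e2 Y h hY.2)
    · exact hS.con_h1 Y ((a5 Y hY).2 h) hY.2

include K in
theorem cored1 {W : ModuleCat.{u} A → Prop} (hW : IsWide W) {F : ModuleCat.{u} A}
    (hF : ExceptionalMod F) (hWF : W F) (M : ModuleCat.{u} A) (hM : FD M) (hWM : W M)
    (h0 : homZero M F) : ∃ M' : ModuleCat.{u} A, FD M' ∧ W M' ∧ rperp M' F ∧
      (∃ e : ℚ, d K M' = d K M + e • d K F) ∧ ∀ Y, rperp Y F →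
        (extZero Y M → extZero Y M') ∧ (homZero Y M' → homZero Y M) := by
  induction hn : ee K M F using Nat.strong_induction_on generalizing M with
  | _ n ih =>
  by_cases h1 : extZero M F
  · exact ⟨M, hM, hWM, ⟨h0, h1⟩, ⟨0, by simp⟩, fun Y _ => ⟨id, id⟩⟩
  · obtain ⟨M1, i, p, hS, h01⟩ := couniv_step hF h0 h1
    have hc := chi_con K hA hS hF.fd hF.fd hM
    have hp := chi_self K hF
    have hlt : ee K M1 F < n := by
      have : (ee K M1 F : ℚ) < ee K M F := by
        simp only [chi, hh_of_homZero K h0, hh_of_homZero K h01] at hc hp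
        push_cast at hc
        linarith
      rw [← hn]
      exact_mod_cast this
    obtain ⟨M', a1, a2, a3, ⟨e, a4⟩, a5⟩ := ih _ hlt M1 (hS.fd2 K hF.fd hM) (hW.ext hS hWF hWM)
      h01 rfl
    refine ⟨M', a1, a2, a3, ⟨e + 1, ?_⟩, fun Y hY => ⟨fun h => ?_, fun h => ?_⟩⟩
    · rw [a4, d_add K hA hS hF.fd hM]
      module
    · exact (a5 Y hY).1 (hS.cov_e2 Y hY.2 h)
    · exact hS.cov_h3 Y ((a5 Y hY).2 h) hY.2

include K in
theorem red2 {W : ModuleCat.{u} A → Prop} (hW : IsWide W) {F : ModuleCat.{u} A}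
    (hF : ExceptionalMod F) (hWF : W F) (M : ModuleCat.{u} A) (hM : FD M) (hWM : W M) :
    ∃ M' : ModuleCat.{u} A, FD M' ∧ W M' ∧ rperp F M' ∧ ∀ Y, rperp F Y →
        (extZero M Y → extZero M' Y) ∧ (homZero M' Y → homZero M Y) := by
  induction hn : dm K M using Nat.strong_induction_on generalizing M with
  | _ n ih =>
  by_cases h0 : homZero F M
  · obtain ⟨M', a1, a2, a3, _, a5⟩ := red1 K hA hW hF hWF M hM hWM h0
    exact ⟨M', a1, a2, a3, a5⟩
  · unfold homZero at h0
    push Not at h0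
    obtain ⟨f, hf⟩ := h0
    obtain ⟨N, I, Q, ι, p, i, π, hS1, hS2, hpi⟩ := factor f
    have hI : ¬ Limits.IsZero I := factor_nz (Q := Q) (ι := ι) hpi hf
    have e2 := dm_add K hA hS2 hM
    have e3 := dm_pos K (hS2.fd1 K hM) hI
    have w := hW.fac hS1 hS2 hWF hWM
    obtain ⟨M', a1, a2, a3, a5⟩ := ih (dm K Q) (by omega) Q (hS2.fd3 K hM) w.2.2 rfl
    refine ⟨M', a1, a2, a3, fun Y hY => ⟨fun h => ?_, fun h => ?_⟩⟩
    · exact (a5 Y hY).1 (hS2.con_e3 Y (hS1.con_h3 Y hY.1) h)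
    · exact hS2.con_h2 Y (hS1.con_h3 Y hY.1) ((a5 Y hY).2 h)

include K in
theorem cored2 {W : ModuleCat.{u} A → Prop} (hW : IsWide W) {F : ModuleCat.{u} A}
    (hF : ExceptionalMod F) (hWF : W F) (M : ModuleCat.{u} A) (hM : FD M) (hWM : W M) :
    ∃ M' : ModuleCat.{u} A, FD M' ∧ W M' ∧ rperp M' F ∧ ∀ Y, rperp Y F →
        (extZero Y M → extZero Y M') ∧ (homZero Y M' → homZero Y M) := by
  induction hn : dm K M using Nat.strong_induction_on generalizing M with
  | _ n ih =>
  by_cases h0 : homZero M F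
  · obtain ⟨M', a1, a2, a3, _, a5⟩ := cored1 K hA hW hF hWF M hM hWM h0
    exact ⟨M', a1, a2, a3, a5⟩
  · unfold homZero at h0
    push Not at h0
    obtain ⟨f, hf⟩ := h0
    obtain ⟨N, I, Q, ι, p, i, π, hS1, hS2, hpi⟩ := factor f
    have hI : ¬ Limits.IsZero I := factor_nz (Q := Q) (ι := ι) hpi hf
    have e2 := dm_add K hA hS1 hM
    have e3 := dm_pos K (hS1.fd3 K hM) hI
    have w := hW.fac hS1 hS2 hWM hWF
    obtain ⟨M', a1, a2, a3, a5⟩ := ih (dm K N) (by omega) N (hS1.fd1 K hM) w.1 rfl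
    refine ⟨M', a1, a2, a3, fun Y hY => ⟨fun h => ?_, fun h => ?_⟩⟩
    · exact (a5 Y hY).1 (hS1.cov_e1 Y (hS2.cov_h1 Y hY.1) h)
    · exact hS1.cov_h2 Y ((a5 Y hY).2 h) (hS2.cov_h1 Y hY.1)

theorem red3 {W : ModuleCat.{u} A → Prop} (hW : IsWide W) {F : ModuleCat.{u} A}
    (hF : ExceptionalMod F) (hWF : W F) (M : ModuleCat.{u} A) (hM : FD M) (hWM : W M) :
    d K M ∈ Submodule.span ℚ {d K F} ⊔ Sp K (fun N => W N ∧ rperp F N) := by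
  have hFm : d K F ∈ Submodule.span ℚ {d K F} ⊔ Sp K (fun N => W N ∧ rperp F N) :=
    Submodule.mem_sup_left (Submodule.mem_span_singleton_self _)
  have key : ∀ M : ModuleCat.{u} A, FD M → W M → homZero F M →
      d K M ∈ Submodule.span ℚ {d K F} ⊔ Sp K (fun N => W N ∧ rperp F N) := by
    intro M hM hWM h0
    obtain ⟨M', a1, a2, a3, ⟨e, a4⟩, _⟩ := red1 K hA hW hF hWF M hM hWM h0
    have : d K M = d K M' - e • d K F := by rw [a4]; simp
    rw [this]
    exact Submodule.sub_mem _ (Submodule.mem_sup_right (Submodule.subset_span ⟨M', ⟨a1, a2, a3⟩, rfl⟩))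
      (Submodule.smul_mem _ _ hFm)
  induction hn : dm K M using Nat.strong_induction_on generalizing M with
  | _ n ih =>
  by_cases h0 : homZero F M
  · exact key M hM hWM h0
  · unfold homZero at h0
    push Not at h0
    obtain ⟨f, hf⟩ := h0
    obtain ⟨N, I, Q, ι, p, i, π, hS1, hS2, hpi⟩ := factor f
    have hI : ¬ Limits.IsZero I := factor_nz (Q := Q) (ι := ι) hpi hf
    have e2 := dm_add K hA hS2 hM
    have e3 := dm_pos K (hS2.fd1 K hM) hI
    have w := hW.fac hS1 hS2 hWF hWM
    have hQ := ih (dm K Q) (by omega) Q (hS2.fd3 K hM) w.2.2 rfl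
    have hN : homZero F N := by
      intro g
      have := hS1.mono
      by_contra hg
      have h1 : g ≫ ι ≠ 0 := fun h => hg (by rw [← cancel_mono ι, h, Limits.zero_comp])
      have := hF.iso _ h1
      have : Epi ι := epi_of_epi g ι
      have : p = 0 := by rw [← cancel_epi ι, hS1.w, Limits.comp_zero]
      exact hf (by rw [← hpi, this, Limits.zero_comp])
    have hN' := key N (hS1.fd1 K hF.fd) w.1 hN
    have e4 := d_add K hA hS2 (hS2.fd1 K hM) (hS2.fd3 K hM)
    have e5 := d_add K hA hS1 (hS1.fd1 K hF.fd) (hS1.fd3 K hF.fd)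
    have : d K M = d K F - d K N + d K Q := by rw [e4, e5]; abel
    rw [this]
    exact Submodule.add_mem _ (Submodule.sub_mem _ hFm hN') hQ

variable {Ω : Type*} [LinearOrder Ω] (E : Ω → ModuleCat.{u} A)

include K in
theorem reds (T : Finset Ω) (hT : ExcOn E T) {W : ModuleCat.{u} A → Prop} (hW : IsWide W)
    (hWT : ∀ u ∈ T, W (E u)) (M : ModuleCat.{u} A) (hM : FD M) (hWM : W M) :
    ∃ M' : ModuleCat.{u} A, FD M' ∧ W M' ∧ (∀ u ∈ T, rperp (E u) M') ∧
      ∀ Y, (∀ u ∈ T, rperp (E u) Y) →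
        (extZero M Y → extZero M' Y) ∧ (homZero M' Y → homZero M Y) := by
  induction T using Finset.induction_on_min with
  | empty => exact ⟨M, hM, hWM, by simp, fun Y _ => ⟨id, id⟩⟩
  | insert a s ha ih =>
    obtain ⟨M1, b1, b2, b3, b4⟩ := ih (hT.mono (Finset.subset_insert _ _))
      (fun u hu => hWT u (Finset.mem_insert_of_mem hu))
    obtain ⟨M', a1, a2, a3, a5⟩ := red2 K hA (F := E a)
      (hW.and (IsWide.all fun u => IsWide.imp (c := u ∈ s) (wide_r hA (E u))))
      (hT.1 a (by simp)) ⟨hWT a (by simp), fun u hu => hT.2 a (by simp) u (by simp [hu]) (ha u hu)⟩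
      M1 b1 ⟨b2, b3⟩
    refine ⟨M', a1, a2.1, ?_, fun Y hY => ?_⟩
    · intro u hu
      rcases Finset.mem_insert.1 hu with rfl | hu
      · exact a3
      · exact a2.2 u hu
    · have h1 := a5 Y (hY a (by simp))
      have h2 := b4 Y (fun u hu => hY u (by simp [hu]))
      exact ⟨fun h => h1.1 (h2.1 h), fun h => h2.2 (h1.2 h)⟩

include K in
theorem coreds (T : Finset Ω) (hT : ExcOn E T) {W : ModuleCat.{u} A → Prop} (hW : IsWide W)
    (hWT : ∀ u ∈ T, W (E u)) (M : ModuleCat.{u} A) (hM : FD M) (hWM : W M) :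
    ∃ M' : ModuleCat.{u} A, FD M' ∧ W M' ∧ (∀ u ∈ T, rperp M' (E u)) ∧
      ∀ Y, (∀ u ∈ T, rperp Y (E u)) →
        (extZero Y M → extZero Y M') ∧ (homZero Y M' → homZero Y M) := by
  induction T using Finset.induction_on_max with
  | empty => exact ⟨M, hM, hWM, by simp, fun Y _ => ⟨id, id⟩⟩
  | insert a s ha ih =>
    obtain ⟨M1, b1, b2, b3, b4⟩ := ih (hT.mono (Finset.subset_insert _ _))
      (fun u hu => hWT u (Finset.mem_insert_of_mem hu))
    obtain ⟨M', a1, a2, a3, a5⟩ := cored2 K hA (F := E a)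
      (hW.and (IsWide.all fun u => IsWide.imp (c := u ∈ s) (wide_l hA (E u))))
      (hT.1 a (by simp)) ⟨hWT a (by simp), fun u hu => hT.2 u (by simp [hu]) a (by simp) (ha u hu)⟩
      M1 b1 ⟨b2, b3⟩
    refine ⟨M', a1, a2.1, ?_, fun Y hY => ?_⟩
    · intro u hu
      rcases Finset.mem_insert.1 hu with rfl | hu
      · exact a3
      · exact a2.2 u hu
    · have h1 := a5 Y (hY a (by simp))
      have h2 := b4 Y (fun u hu => hY u (by simp [hu]))
      exact ⟨fun h => h1.1 (h2.1 h), fun h => h2.2 (h1.2 h)⟩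

theorem redspan (T : Finset Ω) (hT : ExcOn E T) (M : ModuleCat.{u} A) (hM : FD M) :
    d K M ∈ Submodule.span ℚ ((fun u => d K (E u)) '' (T : Set Ω)) ⊔
      Sp K (fun N => ∀ u ∈ T, rperp (E u) N) := by
  induction T using Finset.induction_on_min with
  | empty => exact Submodule.mem_sup_right (Submodule.subset_span ⟨M, ⟨hM, by simp⟩, rfl⟩)
  | insert a s ha ih =>
    have ih := ih (hT.mono (Finset.subset_insert _ _))
    refine SetLike.le_def.1 (sup_le ?_ ?_) ih
    · refine le_sup_of_le_left (Submodule.span_mono ?_)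
      exact Set.image_mono (by simp)
    · refine Submodule.span_le.2 ?_
      rintro _ ⟨N, ⟨hN, hNs⟩, rfl⟩
      have := red3 K hA (F := E a)
        (IsWide.all fun u => IsWide.imp (c := u ∈ s) (wide_r hA (E u)))
        (hT.1 a (by simp)) (fun u hu => hT.2 a (by simp) u (by simp [hu]) (ha u hu))
        N hN hNs
      refine SetLike.le_def.1 (sup_le_sup ?_ ?_) this
      · exact Submodule.span_mono (by simp)
      · refine Submodule.span_mono (Set.image_mono ?_)
        rintro Z ⟨z1, z2, z3⟩
        refine ⟨z1, fun u hu => ?_⟩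
        rcases Finset.mem_insert.1 hu with rfl | hu
        · exact z3
        · exact z2 u hu

omit hA in
/-- minimal-dimension choice -/
theorem exists_min {p : ModuleCat.{u} A → Prop} (h : ∃ X, p X) :
    ∃ X, p X ∧ ∀ Y, p Y → dm K X ≤ dm K Y := by
  obtain ⟨X0, h0⟩ := h
  induction hn : dm K X0 using Nat.strong_induction_on generalizing X0 with
  | _ n ih =>
  by_cases h : ∃ Y, p Y ∧ dm K Y < dm K X0
  · obtain ⟨Y, hY, hlt⟩ := h
    exact ih _ (hn ▸ hlt) Y hY rfl
  · push Not at h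
    exact ⟨X0, h0, h⟩

include K in
/-- exceptional from closure of a class under images of endomorphisms -/
theorem exc_of_min {p : ModuleCat.{u} A → Prop} (X : ModuleCat.{u} A) (hX : p X) (hfd : FD X)
    (hz : ¬ Limits.IsZero X) (hext : extZero X X) (hmin : ∀ Y, p Y → dm K X ≤ dm K Y)
    (him : ∀ (N I Q : ModuleCat.{u} A) (ι : N ⟶ X) (q : X ⟶ I) (i : I ⟶ X) (π : X ⟶ Q),
      SE ι q → SE i π → ¬ Limits.IsZero I → p I) : ExceptionalMod X := by
  refine ExceptionalMod.mk' hfd hext hz fun f hf => ?_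
  obtain ⟨N, I, Q, ι, q, i, π, hS1, hS2, hpi⟩ := factor f
  have hI : ¬ Limits.IsZero I := factor_nz (Q := Q) (ι := ι) hpi hf
  have := hmin I (him _ _ _ _ _ _ _ hS1 hS2 hI)
  have := hS1.epi
  have := hS2.mono
  have := isIso_of_epi K hA q hfd (by assumption)
  have := isIso_of_mono K hA i hfd (by assumption)
  rw [← hpi]
  infer_instance

include K in
theorem minProj {W : ModuleCat.{u} A → Prop} (hW : IsWide W) (Q : ModuleCat.{u} A) (hQ : FD Q)
    (hWQ : W Q) (hz : ¬ Limits.IsZero Q) (hext : ∀ Y, W Y → extZero Q Y) :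
    ∃ X, ExceptionalMod X ∧ W X ∧ ∀ Y, W Y → extZero X Y := by
  obtain ⟨X, ⟨h1, h2, h3, h4⟩, hmin⟩ := exists_min K
    (p := fun X => FD X ∧ W X ∧ ¬ Limits.IsZero X ∧ ∀ Y, W Y → extZero X Y) ⟨Q, hQ, hWQ, hz, hext⟩
  refine ⟨X, exc_of_min K hA X ⟨h1, h2, h3, h4⟩ h1 h3 (h4 X h2) hmin ?_, h2, h4⟩
  intro N I Q ι q i π hS1 hS2 hI
  exact ⟨hS1.fd3 K h1, (hW.fac hS1 hS2 h2 h2).2.1, hI, fun Y hY => hS2.con_e1 Y hA (h4 Y hY)⟩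

end red
end ExcSeq

open CategoryTheory
open Abelian
namespace ExcSeq
set_option linter.unusedSectionVars false
set_option linter.unusedVariables false

/-- maximal length bound -/
def Maxn (A : Type u) [Ring A] (n : ℕ) : Prop :=
  ∀ (m : ℕ) (F : Fin m → ModuleCat.{u} A), IsExcSeq F → m ≤ n

section tri
variable (K : Type u) [Field K] {A : Type u} [Ring A] [Algebra K A] [FiniteDimensional K A]
variable {Ω : Type*} [LinearOrder Ω] {E : Ω → ModuleCat.{u} A} {U : Finset Ω}

theorem d_zero {M : ModuleCat.{u} A} (h : Limits.IsZero M) : d K M = 0 :=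
  Prod.ext (funext fun F => chi_of_rperp K ⟨fun f => h.eq_of_tgt _ _,
      extZero_of_injective h.injective _⟩)
    (funext fun F => chi_of_rperp K ⟨fun f => h.eq_of_src _ _, extZero_of_projective h.projective _⟩)

theorem tri_max (hE : ExcOn E U) (a : Ω → ℚ) {s : Ω} (hs : s ∈ U)
    (h : ∀ u ∈ U, s < u → a u = 0) :
    lf (hE.1 s hs).fd (∑ u ∈ U, a u • d K (E u)) = a s * chi K (E s) (E s) := by
  rw [map_sum, Finset.sum_eq_single s]
  · rw [map_smul, lf_d, smul_eq_mul]
  · intro u hu hne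
    rcases lt_or_gt_of_ne hne with h1 | h1
    · rw [map_smul, lf_d, chi_of_rperp K (hE.2 u hu s hs h1), smul_zero]
    · rw [h u hu h1, zero_smul, map_zero]
  · exact fun h => absurd hs h

theorem tri_min (hE : ExcOn E U) (a : Ω → ℚ) {s : Ω} (hs : s ∈ U)
    (h : ∀ u ∈ U, u < s → a u = 0) :
    rf (hE.1 s hs).fd (∑ u ∈ U, a u • d K (E u)) = a s * chi K (E s) (E s) := by
  rw [map_sum, Finset.sum_eq_single s]
  · rw [map_smul, rf_d, smul_eq_mul]
  · intro u hu hne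
    rcases lt_or_gt_of_ne hne with h1 | h1
    · rw [h u hu h1, zero_smul, map_zero]
    · rw [map_smul, rf_d, chi_of_rperp K (hE.2 s hs u hu h1), smul_zero]
  · exact fun h => absurd hs h

theorem tri_up (hE : ExcOn E U) (a : Ω → ℚ) (D : Ω → Prop)
    (hD : ∀ u v, D u → u < v → D v)
    (h : ∀ u (hu : u ∈ U), D u → lf (hE.1 u hu).fd (∑ u ∈ U, a u • d K (E u)) = 0) :
    ∀ u ∈ U, D u → a u = 0 := by
  classical
  by_contra! hc
  have hne : (U.filter fun u => D u ∧ a u ≠ 0).Nonempty := by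
    obtain ⟨u, h1, h2, h3⟩ := hc
    exact ⟨u, by simp [h1, h2, h3]⟩
  have hm := Finset.max'_mem _ hne
  set m := Finset.max' _ hne
  simp only [Finset.mem_filter] at hm
  have h1 := tri_max K hE a hm.1 (fun u hu hlt => by
    by_contra h0
    have := Finset.le_max' (U.filter fun u => D u ∧ a u ≠ 0) u
      (by simp [hu, h0, hD m u hm.2.1 hlt])
    exact absurd hlt (not_lt.2 this))
  rw [h m hm.1 hm.2.1] at h1
  rcases mul_eq_zero.1 h1.symm with h2 | h2
  · exact hm.2.2 h2
  · exact (chi_self K (hE.1 m hm.1)).ne' h2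

theorem tri_down (hE : ExcOn E U) (a : Ω → ℚ) (D : Ω → Prop)
    (hD : ∀ u v, D u → v < u → D v)
    (h : ∀ u (hu : u ∈ U), D u → rf (hE.1 u hu).fd (∑ u ∈ U, a u • d K (E u)) = 0) :
    ∀ u ∈ U, D u → a u = 0 := by
  classical
  by_contra! hc
  have hne : (U.filter fun u => D u ∧ a u ≠ 0).Nonempty := by
    obtain ⟨u, h1, h2, h3⟩ := hc
    exact ⟨u, by simp [h1, h2, h3]⟩
  have hm := Finset.min'_mem _ hne
  set m := Finset.min' _ hne
  simp only [Finset.mem_filter] at hm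
  have h1 := tri_min K hE a hm.1 (fun u hu hlt => by
    by_contra h0
    have := Finset.min'_le (U.filter fun u => D u ∧ a u ≠ 0) u
      (by simp [hu, h0, hD m u hm.2.1 hlt])
    exact absurd hlt (not_lt.2 this))
  rw [h m hm.1 hm.2.1] at h1
  rcases mul_eq_zero.1 h1.symm with h2 | h2
  · exact hm.2.2 h2
  · exact (chi_self K (hE.1 m hm.1)).ne' h2

variable (hA : Hereditary A)
include hA

include K in
theorem perp_zero {n : ℕ} (hE : ExcOn E U) (hc : U.card = n) (hmax : Maxn A n)
    {M : ModuleCat.{u} A} (hM : FD M) (hp : ∀ u ∈ U, rperp (E u) M) : Limits.IsZero M := by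
  obtain ⟨L, l1, _, l3, l4⟩ := reds K hA E U hE IsWide.true (fun _ _ => trivial) (regA A) regA_fd
    trivial
  by_cases hL : Limits.IsZero L
  · exact isZero_iff_regA.2 ((l4 M hp).2 fun f => hL.eq_of_src _ _)
  exfalso
  obtain ⟨X, x1, x2, x3⟩ := minProj K hA
    (IsWide.all fun u => IsWide.imp (c := u ∈ U) (wide_r hA (E u))) L l1 l3 hL
    (fun Y hY => (l4 Y hY).1 (extZero_of_projective regA_proj _))
  let e := U.orderEmbOfFin hc
  have he : ∀ i, e i ∈ U := fun i => Finset.orderEmbOfFin_mem U hc i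
  have := hmax (n + 1) (Fin.cons X (fun i => E (e i))) ⟨?_, ?_⟩
  · omega
  · refine Fin.cases ?_ ?_
    · simpa using x1
    · intro i; simpa using hE.1 _ (he i)
  · refine Fin.cases ?_ ?_
    · refine Fin.cases ?_ ?_
      · intro h; exact absurd h (lt_irrefl _)
      · intro i _
        simpa using x2 _ (he i)
    · intro i
      refine Fin.cases ?_ ?_
      · intro h; exact absurd h (by simp)
      · intro i' h
        simpa using hE.2 _ (he i) _ (he i') (e.lt_iff_lt.2 (by simpa using h))

theorem coef {n : ℕ} (hE : ExcOn E U) (hc : U.card = n) (hmax : Maxn A n)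
    {M : ModuleCat.{u} A} (hM : FD M) : ∃ a : Ω → ℚ, d K M = ∑ u ∈ U, a u • d K (E u) := by
  have h := redspan K hA E U hE M hM
  have h0 : Sp K (fun N => ∀ u ∈ U, rperp (E u) N) = ⊥ := by
    refine Submodule.span_eq_bot.2 ?_
    rintro _ ⟨N, ⟨h1, h2⟩, rfl⟩
    exact d_zero K (perp_zero K hA hE hc hmax h1 h2)
  rw [h0, sup_bot_eq, Submodule.mem_span_image_finset_iff_exists_fun'] at h
  obtain ⟨c, hc⟩ := h
  exact ⟨c, hc.symm⟩

omit hA in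
/-- the rank one category at slot `s` -/
def Slot (E : Ω → ModuleCat.{u} A) (U : Finset Ω) (s : Ω) (Y : ModuleCat.{u} A) : Prop :=
  (∀ u, u ∈ U ∧ s < u → rperp (E u) Y) ∧ (∀ u, u ∈ U ∧ u < s → rperp Y (E u))

theorem slot_wide (s : Ω) : IsWide (Slot E U s) :=
  (IsWide.all fun u => IsWide.imp (wide_r hA (E u))).and
    (IsWide.all fun u => IsWide.imp (wide_l hA (E u)))

omit hA in
theorem slot_self (hE : ExcOn E U) {s : Ω} (hs : s ∈ U) : Slot E U s (E s) :=
  ⟨fun u hu => hE.2 s hs u hu.1 hu.2, fun u hu => hE.2 u hu.1 s hs hu.2⟩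

section slot
variable {n : ℕ} (hE : ExcOn E U) (hc : U.card = n) (hmax : Maxn A n) {s : Ω} (hs : s ∈ U)
include hE hc hmax hs

theorem slot_d {M : ModuleCat.{u} A} (hM : FD M) (hMs : Slot E U s M) :
    ∃ a : ℚ, d K M = a • d K (E s) ∧ (dm K M : ℚ) = a * dm K (E s) := by
  obtain ⟨a, ha⟩ := coef K hA hE hc hmax hM
  have h1 := tri_up K hE a (fun u => s < u) (fun u v h h' => h.trans h') (fun u hu h => by
    rw [← ha, lf_d]; exact chi_of_rperp K (hMs.1 u ⟨hu, h⟩))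
  have h2 := tri_down K hE a (fun u => u < s) (fun u v h h' => h'.trans h) (fun u hu h => by
    rw [← ha, rf_d]; exact chi_of_rperp K (hMs.2 u ⟨hu, h⟩))
  have h3 : d K M = a s • d K (E s) := by
    rw [ha, Finset.sum_eq_single s]
    · intro u hu hne
      rcases lt_or_gt_of_ne hne with h | h
      · rw [h2 u hu h, zero_smul]
      · rw [h1 u hu h, zero_smul]
    · exact fun h => absurd hs h
  refine ⟨a s, h3, ?_⟩
  have := congrArg (lf (regA_fd (A := A))) h3
  rw [map_smul, lf_d, lf_d, dm_chi, dm_chi] at this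
  simpa using this

include K in
theorem slot_hom {M N : ModuleCat.{u} A} (hM : FD M) (hMs : Slot E U s M) (hMz : ¬ Limits.IsZero M)
    (hN : FD N) (hNs : Slot E U s N) (hNz : ¬ Limits.IsZero N) : ¬ homZero M N := by
  obtain ⟨a, a1, a2⟩ := slot_d K hA hE hc hmax hs hM hMs
  obtain ⟨b, b1, b2⟩ := slot_d K hA hE hc hmax hs hN hNs
  have hd : (0:ℚ) < dm K (E s) := by exact_mod_cast dm_pos K (hE.1 s hs).fd (hE.1 s hs).nz
  have hM0 : (0:ℚ) < dm K M := by exact_mod_cast dm_pos K hM hMz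
  have hN0 : (0:ℚ) < dm K N := by exact_mod_cast dm_pos K hN hNz
  have ha : 0 < a := pos_of_mul_pos_left (a2 ▸ hM0) hd.le
  have hb : 0 < b := pos_of_mul_pos_left (b2 ▸ hN0) hd.le
  apply not_homZero_of_chi K
  have e1 : chi K M N = b * chi K M (E s) := by
    rw [← lf_d K hM, b1, map_smul, lf_d, smul_eq_mul]
  have e2 : chi K M (E s) = a * chi K (E s) (E s) := by
    rw [← rf_d K (hE.1 s hs).fd, a1, map_smul, rf_d, smul_eq_mul]
  rw [e1, e2]
  have := chi_self K (hE.1 s hs)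
  positivity

include K in
theorem slot_min : ∃ S : ModuleCat.{u} A, (FD S ∧ Slot E U s S ∧ ¬ Limits.IsZero S) ∧
    (∀ Y, FD Y ∧ Slot E U s Y ∧ ¬ Limits.IsZero Y → dm K S ≤ dm K Y) ∧
    ∀ X, ExceptionalMod X → Slot E U s X → Nonempty (X ≅ S) := by
  obtain ⟨S, hS, hmin⟩ := exists_min K (p := fun X => FD X ∧ Slot E U s X ∧ ¬ Limits.IsZero X)
    ⟨E s, (hE.1 s hs).fd, slot_self hE hs, (hE.1 s hs).nz⟩
  refine ⟨S, hS, hmin, fun X hX hXs => ?_⟩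
  have hf := slot_hom K hA hE hc hmax hs hX.fd hXs hX.nz hS.1 hS.2.1 hS.2.2
  have hg := slot_hom K hA hE hc hmax hs hS.1 hS.2.1 hS.2.2 hX.fd hXs hX.nz
  unfold homZero at hf hg
  push Not at hf hg
  obtain ⟨f, hf⟩ := hf
  obtain ⟨g, hg⟩ := hg
  have hfe : Epi f := by
    obtain ⟨N, I, Q, ι, q, i, π, hS1, hS2, hpi⟩ := factor f
    have hI : ¬ Limits.IsZero I := factor_nz (Q := Q) (ι := ι) hpi hf
    have := hS2.mono
    have := hS1.epi
    have := isIso_of_mono K hA i hS.1 (hmin I ⟨hS1.fd3 K hX.fd,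
      ((slot_wide hA s).fac hS1 hS2 hXs hS.2.1).2.1, hI⟩)
    rw [← hpi]; infer_instance
  have : IsIso (f ≫ g) := hX.iso _ fun h => hg (by rw [← cancel_epi f, h, Limits.comp_zero])
  have : Mono f := mono_of_mono f g
  have : IsIso f := isIso_of_mono_of_epi f
  exact ⟨asIso f⟩

include K in
theorem slot_unique {X : ModuleCat.{u} A} (hX : ExceptionalMod X) (hXs : Slot E U s X) :
    Nonempty (X ≅ E s) := by
  obtain ⟨S, _, _, h⟩ := slot_min K hA hE hc hmax hs
  obtain ⟨e⟩ := h X hX hXs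
  obtain ⟨e'⟩ := h _ (hE.1 s hs) (slot_self hE hs)
  exact ⟨e.trans e'.symm⟩

theorem slot_le {Y : ModuleCat.{u} A} (hY : FD Y) (hYs : Slot E U s Y) (hYz : ¬ Limits.IsZero Y) :
    dm K (E s) ≤ dm K Y := by
  obtain ⟨S, _, hm, h⟩ := slot_min K hA hE hc hmax hs
  obtain ⟨e'⟩ := h _ (hE.1 s hs) (slot_self hE hs)
  have h1 := dm_add K hA (SE.of_epi e'.inv) (by
    have : Module.Finite A (E s) := (hE.1 s hs).fd
    exact Module.Finite.equiv e'.toLinearEquiv)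
  have := hm Y ⟨hY, hYs, hYz⟩
  omega

include K in
theorem slot_ext (M : ModuleCat.{u} A) (hM : FD M) (hMs : Slot E U s M) : extZero M (E s) := by
  induction hn : dm K M using Nat.strong_induction_on generalizing M with
  | _ n ih =>
  by_cases hz : Limits.IsZero M
  · exact extZero_of_projective hz.projective _
  have hX := hE.1 s hs
  have hf := slot_hom K hA hE hc hmax hs hM hMs hz hX.fd (slot_self hE hs) hX.nz
  unfold homZero at hf
  push Not at hf
  obtain ⟨f, hf⟩ := hf
  obtain ⟨N, I, Q, ι, q, i, π, hS1, hS2, hpi⟩ := factor f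
  have hI : ¬ Limits.IsZero I := factor_nz (Q := Q) (ι := ι) hpi hf
  have w := (slot_wide hA s).fac hS1 hS2 hMs (slot_self hE hs)
  have hIf := hS1.fd3 K hM
  have := hS2.mono
  have := isIso_of_mono K hA i hX.fd (slot_le K hA hE hc hmax hs hIf w.2.1 hI)
  have e := dm_add K hA hS1 hM
  have e' := dm_pos K hIf hI
  have h1 := ih (dm K N) (by omega) N (hS1.fd1 K hM) w.1 rfl
  have h2 : extZero I (E s) := hX.ext.of_retract ⟨i, inv i, by simp⟩ ⟨𝟙 _, 𝟙 _, by simp⟩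
  exact hS1.con_e2 _ h1 h2

include K in
theorem slot_retract {M : ModuleCat.{u} A} (hM : FD M) (hMs : Slot E U s M)
    (hz : ¬ Limits.IsZero M) : Nonempty (Retract (E s) M) := by
  have hX := hE.1 s hs
  have hf := slot_hom K hA hE hc hmax hs hX.fd (slot_self hE hs) hX.nz hM hMs hz
  unfold homZero at hf
  push Not at hf
  obtain ⟨f, hf⟩ := hf
  obtain ⟨N, I, Q, ι, q, i, π, hS1, hS2, hpi⟩ := factor f
  have hI : ¬ Limits.IsZero I := factor_nz (Q := Q) (ι := ι) hpi hf
  have w := (slot_wide hA s).fac hS1 hS2 (slot_self hE hs) hMs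
  have hIf := hS1.fd3 K hX.fd
  have := hS1.epi
  have := isIso_of_epi K hA q hX.fd (slot_le K hA hE hc hmax hs hIf w.2.1 hI)
  have h1 := slot_ext K hA hE hc hmax hs Q (hS2.fd3 K hM) w.2.2
  obtain ⟨g, hg⟩ := hS2.desc h1 (inv q)
  exact ⟨⟨q ≫ i, g, by rw [Category.assoc, hg]; simp⟩⟩

end slot
end tri
end ExcSeq

open CategoryTheory
open Abelian
namespace ExcSeq
set_option linter.unusedSectionVars false
set_option linter.unusedVariables false

section inj
variable (K : Type u) [Field K] {A : Type u} [Ring A] [Algebra K A] [FiniteDimensional K A]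

theorem injective_of_extZero {I : ModuleCat.{u} A} (h : ∀ Y, extZero Y I) : Injective I :=
  ⟨fun {X Y} g f hf => (SE.of_mono f).desc (h _) g⟩

theorem inj_field (K : Type u) [Field K] (R : ModuleCat.{u} K) : Injective R := by
  refine ⟨fun {X Y} g f hf => ?_⟩
  obtain ⟨l, hl⟩ := LinearMap.exists_leftInverse_of_injective f.hom
    (LinearMap.ker_eq_bot.2 ((ModuleCat.mono_iff_injective f).1 hf))
  refine ⟨ModuleCat.ofHom (g.hom ∘ₗ l), ?_⟩
  ext x
  exact congrArg g.hom (LinearMap.congr_fun hl x)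

include K in
theorem exists_inj_fd {S : ModuleCat.{u} A} (hS : FD S) :
    ∃ (J : ModuleCat.{u} A) (i : S ⟶ J), Injective J ∧ FD J ∧ Mono i := by
  let f : K →+* A := algebraMap K A
  let R := (ModuleCat.restrictScalars f).obj S
  let J := (ModuleCat.coextendScalars f).obj R
  let i : S ⟶ J := (ModuleCat.restrictCoextendScalarsAdj f).unit.app S
  have h1 : Injective R := inj_field K R
  have h2 : Injective J := (ModuleCat.restrictCoextendScalarsAdj f).map_injective _ h1
  refine ⟨J, i, h2, ?_, ?_⟩
  · have hR : Module.Finite K R := by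
      have : Module.Finite A S := hS
      let _ : Module K S := Module.compHom S f
      have : IsScalarTower K A S := ⟨fun c a x => by
        show (c • a) • x = f c • a • x
        rw [Algebra.smul_def, mul_smul]⟩
      exact Module.Finite.trans (R := K) A S
    let _ : Module K J := Module.compHom J f
    have : IsScalarTower K A J := ⟨fun c a x => by
        show (c • a) • x = f c • a • x
        rw [Algebra.smul_def, mul_smul]⟩
    have hX : Module.Finite K ((ModuleCat.restrictScalars f).obj (ModuleCat.of A A)) :=
      Module.Finite.of_surjective (M := A)
        (⟨⟨fun x => x, fun _ _ => rfl⟩, fun c x => Algebra.smul_def c x⟩ :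
          A →ₗ[K] ((ModuleCat.restrictScalars f).obj (ModuleCat.of A A))) (fun x => ⟨x, rfl⟩)
    have : Module.Finite K J := by
      have h3 : Module.Finite K ((ModuleCat.restrictScalars f).obj (ModuleCat.of A A) →ₗ[K] R) :=
        inferInstance
      let ψ : J →ₗ[K] ((ModuleCat.restrictScalars f).obj (ModuleCat.of A A) →ₗ[K] R) :=
        { toFun := fun g => g
          map_add' := fun g h => rfl
          map_smul' := fun c g => by
            ext x
            show g ((show A from x) * f c) = c • g x
            have : ((show A from x) * f c : A) = 
              (c • x : (ModuleCat.restrictScalars f).obj (ModuleCat.of A A)) :=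
              (Algebra.commutes c (show A from x)).symm
            rw [this]
            exact map_smul _ _ _ }
      exact Module.Finite.of_injective ψ (fun g h hgh => hgh)
    exact Module.Finite.of_restrictScalars_finite K A J
  · have : (ModuleCat.restrictScalars f).Faithful := inferInstance
    infer_instance
end inj

section ht
variable (K : Type u) [Field K] {A : Type u} [Ring A] [Algebra K A] [FiniteDimensional K A]
  (hA : Hereditary A)
include hA

section phi
variable (φ : VV A →ₗ[ℚ] ℚ) (h0 : ∀ M : ModuleCat.{u} A, FD M → 0 ≤ φ (d K M))
  {M0 : ModuleCat.{u} A} (hM0 : FD M0) (h1 : 0 < φ (d K M0))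
include h0 hM0 h1

theorem phi_simple : ∃ S : ModuleCat.{u} A, FD S ∧ 0 < φ (d K S) ∧ ¬ Limits.IsZero S ∧
    (∀ (N : ModuleCat.{u} A) (f : N ⟶ S), f ≠ 0 → Epi f) ∧
    (∀ (N : ModuleCat.{u} A) (f : S ⟶ N), f ≠ 0 → Mono f) := by
  obtain ⟨S, ⟨hS, hp⟩, hmin⟩ := exists_min K (p := fun X : ModuleCat.{u} A => FD X ∧ 0 < φ (d K X))
    ⟨M0, hM0, h1⟩
  have hz : ¬ Limits.IsZero S := fun h => by rw [d_zero K h, map_zero] at hp; exact lt_irrefl _ hp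
  have key : ∀ {X Z : ModuleCat.{u} A} {i : X ⟶ S} {p : S ⟶ Z}, SE i p →
      Limits.IsZero X ∨ Limits.IsZero Z := by
    intro X Z i p h
    by_contra! hc
    have a1 := h.fd1 K hS
    have a2 := h.fd3 K hS
    have b1 := dm_pos K a1 hc.1
    have b2 := dm_pos K a2 hc.2
    have b3 := dm_add K hA h hS
    have c1 : φ (d K X) ≤ 0 := by
      by_contra! h'
      have := hmin X ⟨a1, h'⟩
      omega
    have c2 : φ (d K Z) ≤ 0 := by
      by_contra! h'
      have := hmin Z ⟨a2, h'⟩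
      omega
    rw [d_add K hA h a1 a2, map_add] at hp
    linarith
  refine ⟨S, hS, hp, hz, fun N f hf => ?_, fun N f hf => ?_⟩
  · obtain ⟨N', I, Q, ι, q, i, π, hS1, hS2, hpi⟩ := factor f
    have hI : ¬ Limits.IsZero I := factor_nz (Q := Q) (ι := ι) hpi hf
    have hQ := (key hS2).resolve_left hI
    have := hS1.epi
    obtain ⟨w, hS2⟩ := hS2
    have : Epi i := by
      refine Preadditive.epi_of_cancel_zero _ fun g hg => ?_
      have := hS2.epi_g
      obtain ⟨l, hl⟩ := hS2.exact.desc' g hg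
      rw [← hl, hQ.eq_of_src l 0, Limits.comp_zero]
    rw [← hpi]; exact epi_comp q i
  · obtain ⟨N', I, Q, ι, q, i, π, hS1, hS2, hpi⟩ := factor f
    have hI : ¬ Limits.IsZero I := factor_nz (Q := Q) (ι := ι) hpi hf
    have hQ := (key hS1).resolve_right hI
    have := hS2.mono
    obtain ⟨w, hS1⟩ := hS1
    have : Mono q := by
      refine Preadditive.mono_of_cancel_zero _ fun g hg => ?_
      have := hS1.mono_f
      obtain ⟨l, hl⟩ := hS1.exact.lift' g hg
      rw [← hl, hQ.eq_of_tgt l 0, Limits.zero_comp]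
    rw [← hpi]; exact mono_comp q i

theorem phi_proj : ∃ P : ModuleCat.{u} A, Projective P ∧ ExceptionalMod P ∧
    ∀ M, FD M → φ (d K M) = 0 → homZero P M := by
  obtain ⟨S, hS, hp, hz, hepi, hmono⟩ := phi_simple K hA φ h0 hM0 h1
  obtain ⟨P, ⟨p1, p2, q, hq⟩, hmin⟩ := exists_min K
    (p := fun X : ModuleCat.{u} A => FD X ∧ Projective X ∧ ∃ q : X ⟶ S, q ≠ 0) (by
      obtain ⟨N, P, i, p, a1, a2, a3⟩ := exists_proj_fd K hS
      refine ⟨P, a2, a1, p, fun h => hz ?_⟩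
      have := a3.epi
      rw [Limits.IsZero.iff_id_eq_zero, ← cancel_epi p, h, Limits.zero_comp, Limits.zero_comp])
  have key : ∀ {N I : ModuleCat.{u} A} {ι : N ⟶ P} {p : P ⟶ I}, SE ι p → ¬ Limits.IsZero I →
      ∃ r : I ⟶ S, r ≠ 0 := by
    intro N I ι p h hI
    have hN : ι ≫ q = 0 := by
      by_contra hne
      have e1 := hmin N ⟨h.fd1 K p1, projective_of_extZero fun Y =>
        h.con_e1 Y hA (extZero_of_projective p2 Y), _, hne⟩
      have e2 := dm_add K hA h p1
      have e3 := dm_pos K (h.fd3 K p1) hI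
      omega
    obtain ⟨w, h⟩ := h
    have := h.epi_g
    obtain ⟨l, hl⟩ := h.exact.desc' q hN
    refine ⟨l, fun h0 => hq ?_⟩
    rw [← hl, h0, Limits.comp_zero]
  refine ⟨P, p2, exc_of_min K hA P ⟨p1, p2, q, hq⟩ p1 ?_ (extZero_of_projective p2 _) hmin ?_, ?_⟩
  · exact fun h => hq (h.eq_of_src _ _)
  · intro N I Q ι p i π hS1 hS2 hI
    exact ⟨hS1.fd3 K p1, projective_of_extZero fun Y =>
        hS2.con_e1 Y hA (extZero_of_projective p2 Y), key hS1 hI⟩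
  · intro M hM hM0 g
    by_contra hg
    obtain ⟨N', I, Q, ι, p, i, π, hS1, hS2, hpi⟩ := factor g
    have hI : ¬ Limits.IsZero I := factor_nz (Q := Q) (ι := ι) hpi hg
    obtain ⟨r, hr⟩ := key hS1 hI
    have := hepi _ r hr
    have f1 := hS1.fd3 K p1
    have s := SE.of_epi r
    have e1 := d_add K hA s (s.fd1 K f1) hS
    have e2 := d_add K hA hS2 f1 (hS2.fd3 K hM)
    rw [e2, e1, map_add, map_add] at hM0
    have := h0 _ (hS2.fd3 K hM)
    have := h0 _ (s.fd1 K f1)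
    linarith

theorem phi_inj : ∃ J : ModuleCat.{u} A, Injective J ∧ FD J ∧ ¬ Limits.IsZero J ∧
    ∀ M, FD M → φ (d K M) = 0 → homZero M J := by
  obtain ⟨S, hS, hp, hz, hepi, hmono⟩ := phi_simple K hA φ h0 hM0 h1
  obtain ⟨P, ⟨p1, p2, q, hq⟩, hmin⟩ := exists_min K
    (p := fun X : ModuleCat.{u} A => FD X ∧ Injective X ∧ ∃ q : S ⟶ X, q ≠ 0) (by
      obtain ⟨J, i, a1, a2, a3⟩ := exists_inj_fd K hS
      refine ⟨J, a2, a1, i, fun h => hz ?_⟩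
      rw [Limits.IsZero.iff_id_eq_zero, ← cancel_mono i, h, Limits.comp_zero, Limits.comp_zero])
  have key : ∀ {I Q : ModuleCat.{u} A} {i : I ⟶ P} {π : P ⟶ Q}, SE i π → ¬ Limits.IsZero I →
      ∃ r : S ⟶ I, r ≠ 0 := by
    intro I Q i π h hI
    have hN : q ≫ π = 0 := by
      by_contra hne
      have e1 := hmin Q ⟨h.fd3 K p1, injective_of_extZero fun Y =>
        h.cov_e3 Y hA (extZero_of_injective p2 Y), _, hne⟩
      have e2 := dm_add K hA h p1
      have e3 := dm_pos K (h.fd1 K p1) hI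
      omega
    obtain ⟨w, h⟩ := h
    have := h.mono_f
    obtain ⟨l, hl⟩ := h.exact.lift' q hN
    refine ⟨l, fun h0 => hq ?_⟩
    rw [← hl, h0, Limits.zero_comp]
  refine ⟨P, p2, p1, fun h => hq (h.eq_of_tgt _ _), ?_⟩
  · intro M hM hM0 g
    by_contra hg
    obtain ⟨N', I, Q, ι, p, i, π, hS1, hS2, hpi⟩ := factor g
    have hI : ¬ Limits.IsZero I := factor_nz (Q := Q) (ι := ι) hpi hg
    obtain ⟨r, hr⟩ := key hS2 hI
    have := hmono _ r hr
    have f1 := hS1.fd3 K hM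
    have s := SE.of_mono r
    have e1 := d_add K hA s hS (s.fd3 K f1)
    have e2 := d_add K hA hS1 (hS1.fd1 K hM) f1
    rw [e2, e1, map_add, map_add] at hM0
    have := h0 _ (hS1.fd1 K hM)
    have := h0 _ (s.fd3 K f1)
    linarith

end phi
end ht
end ExcSeq

open CategoryTheory
open Abelian
namespace ExcSeq
set_option linter.unusedSectionVars false
set_option linter.unusedVariables false

section root
variable (K : Type u) [Field K] {A : Type u} [Ring A] [Algebra K A] [FiniteDimensional K A]

theorem CompleteES.excOn {n : ℕ} {E : Fin n → ModuleCat.{u} A} (h : CompleteES E) :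
    ExcOn E Finset.univ := ⟨fun u _ => h.1.1 u, fun u _ v _ => h.1.2 u v⟩

/-- dual functionals -/
theorem exists_dual {n : ℕ} {E : Fin n → ModuleCat.{u} A} (h : CompleteES E) (k : Fin n) :
    ∃ φ : VV A →ₗ[ℚ] ℚ, ∀ q, φ (d K (E q)) = if q = k then 1 else 0 := by
  let f : (Fin n → ℚ) →ₗ[ℚ] VV A := Fintype.linearCombination ℚ (fun q => d K (E q))
  have hf : LinearMap.ker f = ⊥ := by
    rw [LinearMap.ker_eq_bot']
    intro a ha
    have ha' : ∑ u ∈ Finset.univ, a u • d K (E u) = 0 := by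
      rw [← ha]; simp [f, Fintype.linearCombination_apply]
    funext u
    exact tri_up K h.excOn a (fun _ => True) (fun _ _ _ _ => trivial)
      (fun u _ _ => by rw [ha', map_zero]) u (Finset.mem_univ u) trivial
  obtain ⟨g, hg⟩ := LinearMap.exists_leftInverse_of_injective f hf
  refine ⟨(LinearMap.proj k).comp g, fun q => ?_⟩
  have h1 : f (Pi.single q 1) = d K (E q) := by
    simp [f, Fintype.linearCombination_apply_single]
  rw [← h1]
  have h2 := LinearMap.congr_fun hg (Pi.single q 1)
  simp only [LinearMap.comp_apply, LinearMap.id_apply] at h2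
  simp only [LinearMap.comp_apply, h2, LinearMap.proj_apply, Pi.single_apply]
  simp [eq_comm]

variable (hA : Hereditary A)
include hA

section fwd
variable {n : ℕ} {E : Fin n → ModuleCat.{u} A} (h : CompleteES E) (k : Fin n)
include h

theorem relProj_ext (hp : RelProj E k) {M : ModuleCat.{u} A} (hM : Aperp E k M) :
    extZero (E k) M := by
  intro Y i p w hS
  have hY : Aperp E k Y := fun j hj => (wide_r hA (E j)).ext ⟨w, hS⟩ (hM j hj) (hp.1 j hj)
  exact hp.2 Y (E k) hY hp.1 p hS.epi_g (𝟙 _)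

theorem relInj_ext (hp : RelInj E k) {M : ModuleCat.{u} A} (hM : Bperp E k M) :
    extZero M (E k) := by
  intro Y i p w hS
  have hY : Bperp E k Y := fun j hj => (wide_l hA (E j)).ext ⟨w, hS⟩ (hp.1 j hj) (hM j hj)
  obtain ⟨g, hg⟩ := hp.2 (E k) Y hp.1 hY i hS.mono_f (𝟙 _)
  let sp := ShortComplex.Splitting.ofExactOfRetraction _ hS.exact g hg hS.epi_g
  exact ⟨sp.s, sp.s_g⟩

variable (φ : VV A →ₗ[ℚ] ℚ) (hφ : ∀ q, φ (d K (E q)) = if q = k then 1 else 0)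
include hφ

theorem phi_coef (a : Fin n → ℚ) : φ (∑ u, a u • d K (E u)) = a k := by
  simp [map_sum, map_smul, hφ]

/-- threshold subcategory -/
def Th {n : ℕ} (E : Fin n → ModuleCat.{u} A) (k : Fin n) (p q : ℕ) (M : ModuleCat.{u} A) : Prop :=
  (∀ u : Fin n, k.val + q < u.val → rperp (E u) M) ∧
    (∀ u : Fin n, u.val + p < k.val → rperp M (E u))

theorem claim (hP : RelProj E k) (hI : RelInj E k) (p : ℕ) : ∀ (q : ℕ) (M : ModuleCat.{u} A),
    FD M → Th E k p q M → 0 ≤ φ (d K M) := by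
  have hpos := chi_self K (h.1.1 k)
  have base1 : ∀ (M : ModuleCat.{u} A), FD M → Aperp E k M → 0 ≤ φ (d K M) := by
    intro M hM hMA
    obtain ⟨a, ha⟩ := coef K hA h.excOn (Finset.card_fin n) h.2 hM
    have h1 := tri_up K h.excOn a (fun u => k < u) (fun u v h h' => h.trans h') (fun u hu h => by
      rw [← ha, lf_d]; exact chi_of_rperp K (hMA u h))
    have h2 := tri_max K h.excOn a (Finset.mem_univ k) h1
    rw [← ha, lf_d] at h2
    have h3 := chi_nonneg K (relProj_ext hA h k hP hMA)
    rw [h2] at h3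
    rw [ha, phi_coef K hA h k φ hφ]
    exact nonneg_of_mul_nonneg_left h3 hpos
  have base2 : ∀ (M : ModuleCat.{u} A), FD M → Bperp E k M → 0 ≤ φ (d K M) := by
    intro M hM hMA
    obtain ⟨a, ha⟩ := coef K hA h.excOn (Finset.card_fin n) h.2 hM
    have h1 := tri_down K h.excOn a (fun u => u < k) (fun u v h h' => h'.trans h) (fun u hu h => by
      rw [← ha, rf_d]; exact chi_of_rperp K (hMA u h))
    have h2 := tri_min K h.excOn a (Finset.mem_univ k) h1
    rw [← ha, rf_d] at h2
    have h3 := chi_nonneg K (relInj_ext hA h k hI hMA)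
    rw [h2] at h3
    rw [ha, phi_coef K hA h k φ hφ]
    exact nonneg_of_mul_nonneg_left h3 hpos
  induction p with
  | zero => exact fun q M hM hT => base2 M hM fun u hu => hT.2 u (by simpa using hu)
  | succ p ihp =>
  intro q
  induction q with
  | zero => exact fun M hM hT => base1 M hM fun u hu => hT.1 u (by simpa using hu)
  | succ q ihq =>
  intro M hM hT
  by_cases hj : n ≤ k.val + q + 1
  · exact ihq M hM ⟨fun u hu => by have := u.isLt; omega, hT.2⟩
  by_cases hi : k.val ≤ p
  · exact ihp (q+1) M hM ⟨hT.1, fun u hu => by omega⟩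
  push Not at hj hi
  obtain ⟨i, hiv⟩ : ∃ i : Fin n, i.val + p + 1 = k.val :=
    ⟨⟨k.val - p - 1, by have := k.isLt; omega⟩, by simp only; omega⟩
  obtain ⟨j, hjv⟩ : ∃ j : Fin n, j.val = k.val + q + 1 := ⟨⟨k.val + q + 1, hj⟩, rfl⟩
  have hW : IsWide (Th E k (p+1) (q+1)) := 
    (IsWide.all fun u => IsWide.imp (wide_r hA (E u))).and
      (IsWide.all fun u => IsWide.imp (wide_l hA (E u)))
  have hWj : Th E k (p+1) (q+1) (E j) :=
    ⟨fun u hu => h.1.2 j u (Fin.lt_def.2 (by omega)), fun u hu => h.1.2 u j (Fin.lt_def.2 (by omega))⟩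
  have hWi : Th E k (p+1) (q+1) (E i) :=
    ⟨fun u hu => h.1.2 i u (Fin.lt_def.2 (by omega)), fun u hu => h.1.2 u i (Fin.lt_def.2 (by omega))⟩
  have hij : rperp (E j) (E i) := h.1.2 i j (Fin.lt_def.2 (by omega))
  have hφi : φ (d K (E i)) = 0 := by
    rw [hφ, if_neg]; intro h; rw [h] at hiv; omega
  have hφj : φ (d K (E j)) = 0 := by
    rw [hφ, if_neg]; intro h; rw [h] at hjv; omega
  induction hn : dm K M using Nat.strong_induction_on generalizing M with
  | _ m ih =>
  by_cases c1 : homZero (E j) M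
  · obtain ⟨M', a1, a2, a3, ⟨e, a4⟩, _⟩ := red1 K hA hW (h.1.1 j) hWj M hM hT c1
    have := ihq M' a1 ⟨fun u hu => ?_, a2.2⟩
    · rw [a4, map_add, map_smul, hφj, smul_zero, add_zero] at this
      exact this
    · rcases (by omega : k.val + (q + 1) < u.val ∨ u.val = j.val) with h' | h'
      · exact a2.1 u h'
      · rw [Fin.ext h']; exact a3
  by_cases c2 : homZero M (E i)
  · obtain ⟨M', a1, a2, a3, ⟨e, a4⟩, _⟩ := cored1 K hA hW (h.1.1 i) hWi M hM hT c2
    have := ihp (q+1) M' a1 ⟨a2.1, fun u hu => ?_⟩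
    · rw [a4, map_add, map_smul, hφi, smul_zero, add_zero] at this
      exact this
    · rcases (by omega : u.val + (p + 1) < k.val ∨ u.val = i.val) with h' | h'
      · exact a2.2 u h'
      · rw [Fin.ext h']; exact a3
  unfold homZero at c1
  push Not at c1
  obtain ⟨f, hf⟩ := c1
  obtain ⟨N, I, Q, ι, r, s, π, hS1, hS2, hpi⟩ := factor f
  have hI0 : ¬ Limits.IsZero I := factor_nz (Q := Q) (ι := ι) hpi hf
  have w := hW.fac hS1 hS2 hWj hT
  have f1 := hS2.fd1 K hM
  have f3 := hS2.fd3 K hM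
  have hQ0 : ¬ Limits.IsZero Q := fun hQ => c2 (hS2.con_h2 _ (hS1.con_h3 _ hij.1)
    (fun g => hQ.eq_of_src _ _))
  have e := dm_add K hA hS2 hM
  have e1 := dm_pos K f1 hI0
  have e3 := dm_pos K f3 hQ0
  have g1 := ih (dm K I) (by omega) I f1 w.2.1 rfl
  have g3 := ih (dm K Q) (by omega) Q f3 w.2.2 rfl
  rw [d_add K hA hS2 f1 f3, map_add]
  linarith

end fwd

include K in
theorem root_fwd {n : ℕ} {E : Fin n → ModuleCat.{u} A} (h : CompleteES E) (k : Fin n)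
    (hP : RelProj E k) (hI : RelInj E k) : ∃ P : ModuleCat.{u} A, Projective P ∧
      ExceptionalMod P ∧ ∀ q, q ≠ k → homZero P (E q) := by
  obtain ⟨φ, hφ⟩ := exists_dual K h k
  obtain ⟨P, p1, p2, p3⟩ := phi_proj K hA φ (fun M hM => claim K hA h k φ hφ hP hI n n M hM
    ⟨fun u hu => by have := u.isLt; omega, fun u hu => by have := k.isLt; omega⟩)
    (h.1.1 k).fd (by rw [hφ]; simp)
  refine ⟨P, p1, p2, fun q hq => p3 _ (h.1.1 q).fd (by rw [hφ, if_neg hq])⟩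

include K in
theorem root_bwd {n : ℕ} {E : Fin n → ModuleCat.{u} A} (h : CompleteES E) (k : Fin n)
    {P : ModuleCat.{u} A} (p1 : Projective P) (p2 : ExceptionalMod P)
    (p3 : ∀ q, q ≠ k → homZero P (E q)) : RelProj E k ∧ RelInj E k := by
  have hcoef : ∀ M : ModuleCat.{u} A, FD M → ∃ a : Fin n → ℚ, d K M = ∑ u, a u • d K (E u) :=
    fun M hM => coef K hA h.excOn (Finset.card_fin n) h.2 hM
  have hself : ∀ k, Slot E Finset.univ k (E k) := fun k => slot_self h.excOn (Finset.mem_univ k)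
  have hPk : ¬ homZero P (E k) := by
    intro h0
    obtain ⟨a, ha⟩ := hcoef P p2.fd
    have h1 := chi_self K p2
    rw [← lf_d K p2.fd, ha, map_sum, Finset.sum_eq_zero] at h1
    · exact lt_irrefl _ h1
    · intro u _
      rw [map_smul, lf_d, chi_of_rperp K, smul_zero]
      refine ⟨?_, extZero_of_projective p1 _⟩
      by_cases hu : u = k
      · rw [hu]; exact h0
      · exact p3 u hu
  obtain ⟨J, j1, j2, j3, j4⟩ := phi_inj K hA (lf p2.fd)
    (fun M hM => by rw [lf_d]; exact chi_nonneg K (extZero_of_projective p1 _)) p2.fd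
    (by rw [lf_d]; exact chi_self K p2)
  have hJ : ∀ q, q ≠ k → homZero (E q) J := fun q hq => j4 _ (h.1.1 q).fd (by
    rw [lf_d]; exact chi_of_rperp K ⟨p3 q hq, extZero_of_projective p1 _⟩)
  have hJk : ¬ homZero (E k) J := by
    intro h0
    obtain ⟨a, ha⟩ := hcoef J j2
    have h1 : 0 < chi K J J := chi_pos K j2 j2 (extZero_of_injective j1 _)
      fun h => j3 (isZero_iff_homZero.2 h)
    rw [← rf_d K j2, ha, map_sum, Finset.sum_eq_zero] at h1
    · exact lt_irrefl _ h1
    · intro u _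
      rw [map_smul, rf_d, chi_of_rperp K, smul_zero]
      refine ⟨?_, extZero_of_injective j1 _⟩
      by_cases hu : u = k
      · rw [hu]; exact h0
      · exact hJ u hu
  have hWl : IsWide (fun Y => ∀ u, u < k → rperp Y (E u)) :=
    IsWide.all fun u => IsWide.imp (wide_l hA (E u))
  have hWr : IsWide (fun Y => ∀ u, k < u → rperp (E u) Y) :=
    IsWide.all fun u => IsWide.imp (wide_r hA (E u))
  constructor
  · obtain ⟨L, l1, l2, l3, l4⟩ := reds K hA E (Finset.univ.filter fun u => k < u)
      (h.excOn.mono (Finset.subset_univ _)) hWl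
      (fun v hv u hu => h.1.2 u v (hu.trans (Finset.mem_filter.1 hv).2)) P p2.fd
      (fun u hu => ⟨p3 u hu.ne, extZero_of_projective p1 _⟩)
    have l3' : ∀ u, k < u → rperp (E u) L := fun u hu => l3 u (by simp [hu])
    have hz : ¬ Limits.IsZero L := fun h0 => hPk ((l4 (E k) (fun u hu =>
      h.1.2 k u (Finset.mem_filter.1 hu).2)).2 fun f => h0.eq_of_src _ _)
    obtain ⟨r⟩ := slot_retract K hA h.excOn (Finset.card_fin n) h.2 (Finset.mem_univ k) l1
      ⟨fun u hu => l3' u hu.2, fun u hu => l2 u hu.2⟩ hz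
    have hext : ∀ Y, Aperp E k Y → extZero (E k) Y := fun Y hY =>
      ((l4 Y fun u hu => hY u (Finset.mem_filter.1 hu).2).1 (extZero_of_projective p1 _)).of_retract
        r ⟨𝟙 _, 𝟙 _, by simp⟩
    refine ⟨fun j hj => h.1.2 k j hj, fun Y Z hY hZ p hp f => ?_⟩
    have s := SE.of_epi p
    exact s.lift (hext _ (hWr.ker s hY hZ)) f
  · obtain ⟨L, l1, l2, l3, l4⟩ := coreds K hA E (Finset.univ.filter fun u => u < k)
      (h.excOn.mono (Finset.subset_univ _)) hWr
      (fun v hv u hu => h.1.2 v u ((Finset.mem_filter.1 hv).2.trans hu)) J j2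
      (fun u hu => ⟨hJ u hu.ne', extZero_of_injective j1 _⟩)
    have l3' : ∀ u, u < k → rperp L (E u) := fun u hu => l3 u (by simp [hu])
    have hz : ¬ Limits.IsZero L := fun h0 => hJk ((l4 (E k) (fun u hu =>
      h.1.2 u k (Finset.mem_filter.1 hu).2)).2 fun f => h0.eq_of_tgt _ _)
    obtain ⟨r⟩ := slot_retract K hA h.excOn (Finset.card_fin n) h.2 (Finset.mem_univ k) l1
      ⟨fun u hu => l2 u hu.2, fun u hu => l3' u hu.2⟩ hz
    have hext : ∀ Y, Bperp E k Y → extZero Y (E k) := fun Y hY =>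
      ((l4 Y fun u hu => hY u (Finset.mem_filter.1 hu).2).1 (extZero_of_injective j1 _)).of_retract
        ⟨𝟙 _, 𝟙 _, by simp⟩ r
    refine ⟨fun j hj => h.1.2 j k hj, fun Y Z hY hZ i hi f => ?_⟩
    have s := SE.of_mono i
    exact s.desc (hext _ (hWl.coker s hY hZ)) f

end root
end ExcSeq

open CategoryTheory
open Abelian
namespace ExcSeq
set_option linter.unusedSectionVars false
set_option linter.unusedVariables false

theorem card_rel {α β : Type*} (r : Setoid α) (s : Setoid β) (R : α → β → Prop)
    (tot : ∀ a, ∃ b, R a b) (sur : ∀ b, ∃ a, R a b)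
    (fn : ∀ a a' b b', R a b → R a' b' → r a a' → s b b')
    (inj : ∀ a a' b b', R a b → R a' b' → s b b' → r a a') :
    Nat.card (Quotient r) = Nat.card (Quotient s) := by
  choose f hf using tot
  have hmap : ∀ a a', r a a' → s (f a) (f a') := fun a a' h => fn _ _ _ _ (hf a) (hf a') h
  refine Nat.card_eq_of_bijective (Quotient.map f hmap) ⟨?_, ?_⟩
  · intro x y
    induction x using Quotient.inductionOn with | _ a
    induction y using Quotient.inductionOn with | _ b
    intro h
    rw [Quotient.map_mk, Quotient.map_mk] at h
    exact Quotient.sound (inj _ _ _ _ (hf a) (hf b) (Quotient.exact h))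
  · intro y
    induction y using Quotient.inductionOn with | _ b
    obtain ⟨a, ha⟩ := sur b
    refine ⟨Quotient.mk _ a, ?_⟩
    rw [Quotient.map_mk]
    exact Quotient.sound (fn _ _ _ _ (hf a) ha (r.refl a))

theorem bnd {n k : ℕ} (hk : k ≤ n) (i : Fin k) : n - k + i.val < n := by
  have := i.isLt; omega

section comb

/-- the index order -/
abbrev Om (n k : ℕ) := Fin n ⊕ₗ Fin k
/-- left -/
abbrev il {n k : ℕ} (q : Fin n) : Om n k := toLex (Sum.inl q)
/-- right -/
abbrev ir {n k : ℕ} (m : Fin k) : Om n k := toLex (Sum.inr m)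

variable {n k : ℕ}

theorem il_lt_il {p q : Fin n} : (il p : Om n k) < il q ↔ p < q := Sum.Lex.inl_lt_inl_iff
theorem ir_lt_ir {p q : Fin k} : (ir p : Om n k) < ir q ↔ p < q := Sum.Lex.inr_lt_inr_iff
theorem il_lt_ir (p : Fin n) (q : Fin k) : (il p : Om n k) < ir q := Sum.Lex.inl_lt_inr _ _
theorem not_ir_lt_il (p : Fin n) (q : Fin k) : ¬ (ir q : Om n k) < il p := Sum.Lex.not_inr_lt_inl
theorem Om.cases (x : Om n k) : (∃ q, x = il q) ∨ ∃ m, x = ir m := by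
  rcases h : ofLex x with q | m
  · exact Or.inl ⟨q, by rw [← toLex_ofLex x, h]⟩
  · exact Or.inr ⟨m, by rw [← toLex_ofLex x, h]⟩
theorem il_inj {p q : Fin n} : (il p : Om n k) = il q ↔ p = q := by simp [il]
theorem ir_inj {p q : Fin k} : (ir p : Om n k) = ir q ↔ p = q := by simp [ir]
theorem il_ne_ir {p : Fin n} {q : Fin k} : (il p : Om n k) ≠ ir q := by simp [il, ir]

variable (jj : Fin k → Fin n)

open Classical in
/-- intermediate index sets -/
noncomputable def UU (t : ℕ) : Finset (Om n k) :=
  Finset.univ.filter fun x => Sum.elim (fun q => ∀ m : Fin k, t ≤ m.val → jj m ≠ q)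
    (fun m => t ≤ m.val) (ofLex x)

theorem mem_il {t : ℕ} {q : Fin n} : il q ∈ UU jj t ↔ ∀ m : Fin k, t ≤ m.val → jj m ≠ q := by
  simp [UU]
theorem mem_ir {t : ℕ} {m : Fin k} : ir m ∈ UU jj t ↔ t ≤ m.val := by
  simp [UU]

theorem compl_card (hj : StrictAnti jj) : (Finset.univ \ Finset.univ.image jj).card = n - k := by
  rw [Finset.card_sdiff_of_subset (Finset.subset_univ _),
    Finset.card_image_of_injective _ hj.injective]
  simp

/-- enumeration of `UU 0` -/
noncomputable def e0 (hj : StrictAnti jj) (i : Fin n) : Om n k :=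
  if h : i.val < n - k then il ((Finset.univ \ Finset.univ.image jj).orderEmbOfFin
    (compl_card jj hj) ⟨i.val, h⟩)
  else ir ⟨i.val - (n - k), by have := i.isLt; omega⟩

variable (hk : k ≤ n) (hj : StrictAnti jj)

include hk in
theorem e0_mono : StrictMono (e0 jj hj) := by
  intro a b hab
  unfold e0
  have := Fin.lt_def.1 hab
  split_ifs with h1 h2 h2
  · rw [il_lt_il]; simpa using hab
  · exact il_lt_ir _ _
  · omega
  · rw [ir_lt_ir, Fin.lt_def]; simp only; omega

include hk in
theorem e0_ir (m : Fin k) : e0 jj hj ⟨n - k + m.val, bnd hk m⟩ = ir m := by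
  unfold e0
  rw [dif_neg (by simp)]
  rw [ir_inj]
  ext
  simp

theorem e0_mem (i : Fin n) : e0 jj hj i ∈ UU jj 0 := by
  unfold e0
  split_ifs with h
  · rw [mem_il]
    intro m _ hm
    have := Finset.orderEmbOfFin_mem (Finset.univ \ Finset.univ.image jj) (compl_card jj hj) ⟨i, h⟩
    rw [← hm] at this
    simp at this
  · rw [mem_ir]; simp

include hk in
theorem e0_surj {x : Om n k} (hx : x ∈ UU jj 0) : ∃ i, e0 jj hj i = x := by
  rcases Om.cases x with ⟨q, rfl⟩ | ⟨m, rfl⟩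
  · rw [mem_il] at hx
    have hq : q ∈ Set.range ((Finset.univ \ Finset.univ.image jj).orderEmbOfFin
      (compl_card jj hj)) := by
      rw [Finset.range_orderEmbOfFin]
      simpa using hx
    obtain ⟨⟨i, hi⟩, rfl⟩ := hq
    refine ⟨⟨i, by omega⟩, ?_⟩
    unfold e0
    rw [dif_pos hi]
  · exact ⟨_, e0_ir jj hk hj m⟩

include hj in
theorem UU_succ {t : ℕ} (ht : t < k) :
    UU jj (t + 1) = insert (il (jj ⟨t, ht⟩)) ((UU jj t).erase (ir ⟨t, ht⟩)) := by
  ext x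
  rcases Om.cases x with ⟨q, rfl⟩ | ⟨m, rfl⟩
  · simp only [Finset.mem_insert, Finset.mem_erase, mem_il, il_inj, ne_eq, il_ne_ir,
      not_false_eq_true, true_and]
    constructor
    · intro h
      by_cases hq : q = jj ⟨t, ht⟩
      · exact Or.inl hq
      · right
        intro m hm he
        rcases hm.eq_or_lt with h' | h'
        · exact hq (by rw [← he]; congr 1; ext; exact h'.symm)
        · exact h m h' he
    · rintro (rfl | h) m hm he
      · have := hj.injective he
        rw [this] at hm
        simp at hm
      · exact h m (by omega) he
  · simp only [Finset.mem_insert, Finset.mem_erase, mem_ir, ne_eq, ir_inj, il_ne_ir.symm,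
      false_or, Fin.ext_iff]
    omega

include hk hj in
theorem UU_card {t : ℕ} (ht : t ≤ k) : (UU jj t).card = n := by
  induction t with
  | zero =>
    have : UU jj 0 = Finset.univ.map ⟨e0 jj hj, (e0_mono jj hk hj).injective⟩ := by
      ext x
      simp only [Finset.mem_map, Finset.mem_univ, true_and, Function.Embedding.coeFn_mk]
      exact ⟨fun h => e0_surj jj hk hj h, fun ⟨i, hi⟩ => hi ▸ e0_mem jj hj i⟩
    rw [this]; simp
  | succ t ih =>
    rw [UU_succ jj hj ht, Finset.card_insert_of_notMem, Finset.card_erase_of_mem, ih (by omega)]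
    · have : 0 < n := by omega
      omega
    · rw [mem_ir]
    · rw [Finset.mem_erase, mem_il]
      intro h
      exact h.2 ⟨t, ht⟩ le_rfl rfl

end comb

section bij
variable (K : Type u) [Field K] {A : Type u} [Ring A] [Algebra K A] [FiniteDimensional K A]
  (hA : Hereditary A) {n k : ℕ}

/-- combination -/
def cmb (E : Fin n → ModuleCat.{u} A) (P : Fin k → ModuleCat.{u} A) : Om n k → ModuleCat.{u} A :=
  fun x => Sum.elim E P (ofLex x)

theorem cmb_il (E : Fin n → ModuleCat.{u} A) (P : Fin k → ModuleCat.{u} A) (q : Fin n) :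
    cmb E P (il q) = E q := rfl
theorem cmb_ir (E : Fin n → ModuleCat.{u} A) (P : Fin k → ModuleCat.{u} A) (q : Fin k) :
    cmb E P (ir q) = P q := rfl

/-- compatible data -/
structure Good (jj : Fin k → Fin n) (E : Fin n → ModuleCat.{u} A) (P : Fin k → ModuleCat.{u} A) :
    Prop where
  ce : CompleteES E
  pr : ∀ m, Projective (P m)
  ex : ∀ m, ExceptionalMod (P m)
  hz : ∀ m q, q ≠ jj m → homZero (P m) (E q)

include hA

include K in
theorem proj_unique {P P' : ModuleCat.{u} A} (h1 : Projective P) (h2 : ExceptionalMod P)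
    (h1' : Projective P') (h2' : ExceptionalMod P') {E : Fin n → ModuleCat.{u} A}
    (hE : CompleteES E) (s : Fin n) (h3 : ∀ q, q ≠ s → homZero P (E q))
    (h3' : ∀ q, q ≠ s → homZero P' (E q)) : Nonempty (P ≅ P') := by
  have key : ∀ {P P' : ModuleCat.{u} A} (h1 : Projective P) (h2 : ExceptionalMod P)
    (h1' : Projective P') (h2' : ExceptionalMod P')
     (h3 : ∀ q, q ≠ s → homZero P (E q))
    (h3' : ∀ q, q ≠ s → homZero P' (E q)), ∃ f : P ⟶ P', Mono f := by
    intro P P' h1 h2 h1' h2' h3 h3'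
    have hsum : ∀ {Q R : ModuleCat.{u} A} (a : Fin n → ℚ) (hQ : ExceptionalMod Q)
       (hQp : Projective Q)  (hQ0 : ∀ q, q ≠ s → homZero Q (E q)),
        d K R = ∑ u, a u • d K (E u) → chi K Q R = a s * chi K Q (E s) := by
      intro Q R a hQ hQp hQ0 ha
      rw [← lf_d K hQ.fd, ha, map_sum, Finset.sum_eq_single s]
      · rw [map_smul, lf_d, smul_eq_mul]
      · intro u _ hu
        rw [map_smul, lf_d, chi_of_rperp K ⟨hQ0 u hu, extZero_of_projective hQp _⟩, smul_zero]
      · simp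
    obtain ⟨a, ha⟩ := coef K hA hE.excOn (Finset.card_fin n) hE.2 h2'.fd
    obtain ⟨b, hb⟩ := coef K hA hE.excOn (Finset.card_fin n) hE.2 h2.fd
    have e1 := hsum a h2 h1 h3 ha
    have e2 := hsum a h2' h1' h3' ha
    have e3 := hsum b h2 h1 h3 hb
    have p1 := chi_self K h2
    have p2 := chi_self K h2'
    have hne : ¬ homZero P P' := by
      intro h0
      rw [chi_of_rperp K ⟨h0, extZero_of_projective h1 _⟩] at e1
      rcases mul_eq_zero.1 e1.symm with h | h
      · rw [h, zero_mul] at e2; exact p2.ne' e2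
      · rw [h, mul_zero] at e3; exact p1.ne' e3
    unfold homZero at hne
    push Not at hne
    obtain ⟨f, hf⟩ := hne
    refine ⟨f, ?_⟩
    obtain ⟨N, I, Q, ι, r, i, π, hS1, hS2, hpi⟩ := factor f
    have hI : ¬ Limits.IsZero I := factor_nz (Q := Q) (ι := ι) hpi hf
    have hIp : Projective I := projective_of_extZero fun Y =>
        hS2.con_e1 Y hA (extZero_of_projective h1' Y)
    have := hS1.epi
    have := hS2.mono
    have hs := Projective.factorThru_comp (𝟙 I) r
    set σ := Projective.factorThru (𝟙 I) r
    have : IsIso (r ≫ σ) := h2.iso _ fun h0 => hI (by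
      rw [Limits.IsZero.iff_id_eq_zero]
      calc 𝟙 I = σ ≫ (r ≫ σ) ≫ r := by simp [hs]
        _ = 0 := by rw [h0]; simp)
    have : Mono r := mono_of_mono r σ
    rw [← hpi]; exact mono_comp r i
  obtain ⟨f, hf⟩ := key h1 h2 h1' h2' h3 h3'
  obtain ⟨g, hg⟩ := key h1' h2' h1 h2 h3' h3
  have e1 := dm_add K hA (SE.of_mono g) h2.fd
  have := isIso_of_mono K hA f h2'.fd (by omega)
  exact ⟨asIso f⟩

variable {jj : Fin k → Fin n} (hk : k ≤ n) (hj : StrictAnti jj)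

include K hj in
theorem Good.pp {E : Fin n → ModuleCat.{u} A} {P : Fin k → ModuleCat.{u} A} (h : Good jj E P)
    {m m' : Fin k} (hm : m < m') : rperp (P m') (P m) := by
  refine ⟨?_, extZero_of_projective (h.pr _) _⟩
  refine homZero_of_chi K (h.ex _).fd (h.ex _).fd (extZero_of_projective (h.pr _) _) ?_
  obtain ⟨a, ha⟩ := coef K hA h.ce.excOn (Finset.card_fin n) h.ce.2 (h.ex m).fd
  have h2 := tri_down K h.ce.excOn a (fun u => u < jj m) (fun u v h h' => h'.trans h)
    (fun u hu hlt => by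
      rw [← ha, rf_d]; exact chi_of_rperp K ⟨h.hz m u hlt.ne, extZero_of_projective (h.pr _) _⟩)
  rw [← lf_d K (h.ex m').fd, ha, map_sum, Finset.sum_eq_zero]
  intro u _
  by_cases hu : u = jj m'
  · rw [h2 u (Finset.mem_univ u) (hu ▸ hj hm), zero_smul, map_zero]
  · rw [map_smul, lf_d, chi_of_rperp K ⟨h.hz m' u hu, extZero_of_projective (h.pr _) _⟩, smul_zero]

include K hj in
theorem Good.excOn {E : Fin n → ModuleCat.{u} A} {P : Fin k → ModuleCat.{u} A} (h : Good jj E P)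
    (t : ℕ) : ExcOn (cmb E P) (UU jj t) := by
  constructor
  · intro x hx
    rcases Om.cases x with ⟨q, rfl⟩ | ⟨m, rfl⟩
    · exact h.ce.1.1 q
    · exact h.ex m
  · intro x hx y hy hxy
    rcases Om.cases x with ⟨q, rfl⟩ | ⟨m, rfl⟩ <;> rcases Om.cases y with ⟨q', rfl⟩ | ⟨m', rfl⟩
    · exact h.ce.1.2 _ _ (il_lt_il.1 hxy)
    · exact ⟨h.hz m' q ((mem_il jj).1 hx m' ((mem_ir jj).1 hy)).symm,
        extZero_of_projective (h.pr _) _⟩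
    · exact absurd hxy (not_ir_lt_il _ _)
    · exact h.pp K hA hj (ir_lt_ir.1 hxy)

omit hA in
/-- the correspondence -/
def Corr (jj : Fin k → Fin n) (hj : StrictAnti jj) (E E' : Fin n → ModuleCat.{u} A) : Prop :=
  ∃ P : Fin k → ModuleCat.{u} A, Good jj E P ∧ ∀ i, Nonempty (E' i ≅ cmb E P (e0 jj hj i))

include K hk in
theorem corr_total {E : Fin n → ModuleCat.{u} A} (hE : CompleteES E)
    (hr : ∀ m, RelProj E (jj m) ∧ RelInj E (jj m)) :
    ∃ E' : Fin n → ModuleCat.{u} A, (CompleteES E' ∧ ∀ i : Fin k,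
      Projective (E' ⟨n - k + i.val, bnd hk i⟩)) ∧ Corr jj hj E E' := by
  choose P hP1 hP2 hP3 using fun m => root_fwd K hA hE (jj m) (hr m).1 (hr m).2
  have hg : Good jj E P := ⟨hE, hP1, hP2, hP3⟩
  have hx := hg.excOn K hA hj 0
  refine ⟨fun i => cmb E P (e0 jj hj i), ⟨⟨⟨fun i => hx.1 _ (e0_mem jj hj i), fun i i' hi =>
    hx.2 _ (e0_mem jj hj i) _ (e0_mem jj hj i') (e0_mono jj hk hj hi)⟩, hE.2⟩, ?_⟩,
    P, hg, fun i => ⟨Iso.refl _⟩⟩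
  intro m
  show Projective (cmb E P (e0 jj hj _))
  rw [e0_ir jj hk hj m]
  exact hP1 m

include K in
theorem corr_fn {E₁ E₂ E₁' E₂' : Fin n → ModuleCat.{u} A} (h1 : Corr jj hj E₁ E₁')
    (h2 : Corr jj hj E₂ E₂') (h : ∀ i, Nonempty (E₁ i ≅ E₂ i)) (i : Fin n) :
    Nonempty (E₁' i ≅ E₂' i) := by
  obtain ⟨P1, g1, r1⟩ := h1
  obtain ⟨P2, g2, r2⟩ := h2
  have : Nonempty (cmb E₁ P1 (e0 jj hj i) ≅ cmb E₂ P2 (e0 jj hj i)) := by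
    rcases Om.cases (e0 jj hj i) with ⟨q, hq⟩ | ⟨m, hm⟩
    · rw [hq]; exact h q
    · rw [hm]
      refine proj_unique K hA (g1.pr m) (g1.ex m) (g2.pr m) (g2.ex m) g1.ce (jj m) (g1.hz m) ?_
      intro q hq
      obtain ⟨e⟩ := h q
      show homZero (P2 m) (E₁ q)
      exact (g2.hz m q hq).of_retract ⟨𝟙 _, 𝟙 _, by simp⟩ ⟨e.hom, e.inv, by simp⟩
  exact ⟨(r1 i).some.trans (this.some.trans (r2 i).some.symm)⟩

include K hk in
theorem corr_inj {E₁ E₂ E₁' E₂' : Fin n → ModuleCat.{u} A} (h1 : Corr jj hj E₁ E₁')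
    (h2 : Corr jj hj E₂ E₂') (h : ∀ i, Nonempty (E₁' i ≅ E₂' i)) (i : Fin n) :
    Nonempty (E₁ i ≅ E₂ i) := by
  obtain ⟨P1, g1, r1⟩ := h1
  obtain ⟨P2, g2, r2⟩ := h2
  have key : ∀ t, t ≤ k → ∀ x ∈ UU jj t, Nonempty (cmb E₁ P1 x ≅ cmb E₂ P2 x) := by
    intro t
    induction t with
    | zero =>
      intro _ x hx
      obtain ⟨i, rfl⟩ := e0_surj jj hk hj hx
      exact ⟨(r1 i).some.symm.trans ((h i).some.trans (r2 i).some)⟩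
    | succ t ih =>
      intro ht x hx
      have ih := ih (by omega)
      have hU := UU_succ jj hj ht
      have hold : ∀ y ∈ UU jj (t+1), y ≠ il (jj ⟨t, ht⟩) → Nonempty (cmb E₁ P1 y ≅ cmb E₂ P2 y) := by
        intro y hy hne
        rw [hU, Finset.mem_insert] at hy
        exact ih y (Finset.mem_of_mem_erase (hy.resolve_left hne))
      by_cases hxs : x = il (jj ⟨t, ht⟩)
      · have x2 := g2.excOn K hA hj (t+1)
        refine (slot_unique K hA (g1.excOn K hA hj (t+1)) (UU_card jj hk hj ht) g1.ce.2 hx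
          (x2.1 x hx) ⟨?_, ?_⟩).map Iso.symm
        · intro u hu
          obtain ⟨e⟩ := hold u hu.1 (hxs ▸ hu.2.ne')
          exact (x2.2 x hx u hu.1 hu.2).of_retract ⟨e.hom, e.inv, by simp⟩ ⟨𝟙 _, 𝟙 _, by simp⟩
        · intro u hu
          obtain ⟨e⟩ := hold u hu.1 (hxs ▸ hu.2.ne)
          exact (x2.2 u hu.1 x hx hu.2).of_retract ⟨𝟙 _, 𝟙 _, by simp⟩ ⟨e.hom, e.inv, by simp⟩
      · exact hold x hx hxs
  exact key k le_rfl (il i) ((mem_il jj).2 fun m hm => absurd m.isLt (by omega))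

end bij
end ExcSeq

open CategoryTheory
open Abelian
namespace ExcSeq
set_option linter.unusedSectionVars false
set_option linter.unusedVariables false

section surj
variable (K : Type u) [Field K] {A : Type u} [Ring A] [Algebra K A] [FiniteDimensional K A]
  (hA : Hereditary A) {n k : ℕ}
include hA

include K in
theorem mut_nz {Ω : Type*} [LinearOrder Ω] {E : Ω → ModuleCat.{u} A} {T : Finset Ω} {s : Ω}
    (hs : s ∉ T) (hE : ExcOn E (insert s T)) (hP : Projective (E s))
    (h0 : ∀ Y, (∀ u ∈ T, rperp (E u) Y) → homZero (E s) Y) : False := by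
  have h := redspan K hA E T (hE.mono (Finset.subset_insert _ _)) (E s) (hE.1 s (by simp)).fd
  obtain ⟨x, hx, y, hy, hxy⟩ := Submodule.mem_sup.1 h
  rw [Submodule.mem_span_image_finset_iff_exists_fun'] at hx
  obtain ⟨c, hc⟩ := hx
  have hlf : ∀ u (hu : u ∈ insert s T), lf (hE.1 u hu).fd y = 0 := by
    intro u hu
    have : Sp K (fun N => ∀ u ∈ T, rperp (E u) N) ≤ LinearMap.ker (lf (hE.1 u hu).fd) := by
      refine Submodule.span_le.2 ?_
      rintro _ ⟨N, ⟨hN, hNs⟩, rfl⟩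
      show lf _ (d K N) = 0
      rw [lf_d]
      refine chi_of_rperp K ?_
      rcases Finset.mem_insert.1 hu with rfl | hu'
      · exact ⟨h0 N hNs, extZero_of_projective hP _⟩
      · exact hNs u hu'
    exact this hy
  let b : Ω → ℚ := fun u => if u = s then 1 else - c u
  have hb : ∑ u ∈ insert s T, b u • d K (E u) = y := by
    rw [Finset.sum_insert hs]
    have : ∑ u ∈ T, b u • d K (E u) = - x := by
      rw [← hc, ← Finset.sum_neg_distrib]
      refine Finset.sum_congr rfl fun u hu => ?_
      have : u ≠ s := fun h => hs (h ▸ hu)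
      simp [b, this]
    rw [this, ← hxy]
    simp [b]
  have := tri_up K hE b (fun _ => True) (fun _ _ _ _ => trivial)
    (fun u hu _ => by rw [hb]; exact hlf u hu) s (by simp) trivial
  simp [b] at this

variable {jj : Fin k → Fin n} (hk : k ≤ n) (hj : StrictAnti jj)

include K hk hj in
theorem surj_step {P : Fin k → ModuleCat.{u} A} (hP : ∀ m, Projective (P m))
    (hPe : ∀ m, ExceptionalMod (P m)) (hPP : ∀ m m', m < m' → rperp (P m') (P m))
    (hmax : Maxn A n) {t : ℕ} (ht : t < k) {F : Om n k → ModuleCat.{u} A}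
    (hF : ExcOn F (UU jj t)) (hFP : ∀ m, F (ir m) = P m)
    (hz : ∀ m q, m.val < t → il q ∈ UU jj t → q ≠ jj m → homZero (P m) (F (il q))) :
    ∃ X, ExcOn (Function.update F (il (jj ⟨t, ht⟩)) X) (UU jj (t+1)) ∧
      ∀ m q, m.val < t + 1 → il q ∈ UU jj (t+1) → q ≠ jj m →
        homZero (P m) (Function.update F (il (jj ⟨t, ht⟩)) X (il q)) := by
  have hU := UU_succ jj hj ht
  set τ : Fin k := ⟨t, ht⟩ with hτ
  set s : Om n k := il (jj τ) with hs
  have hsτ : s < ir τ := il_lt_ir _ _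
  have hτU : ir τ ∈ UU jj t := (mem_ir jj).2 le_rfl
  have hsU : s ∉ UU jj t := fun h => (mem_il jj).1 h τ le_rfl rfl
  have hold : ∀ u ∈ UU jj (t+1), u ≠ s → u ∈ UU jj t ∧ u ≠ ir τ := by
    intro u hu hne
    rw [hU, Finset.mem_insert, Finset.mem_erase] at hu
    exact (hu.resolve_left hne).symm
  have hnew : ∀ u ∈ UU jj t, u ≠ ir τ → u ∈ UU jj (t+1) := by
    intro u hu hne
    rw [hU, Finset.mem_insert, Finset.mem_erase]
    exact Or.inr ⟨hne, hu⟩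
  classical
  set T := (UU jj t).filter (fun u => s < u ∧ u ≠ ir τ) with hT
  have hTs : insert (ir τ) T ⊆ UU jj t := Finset.insert_subset hτU (Finset.filter_subset _ _)
  have hTE := hF.mono hTs
  have hτT : ir τ ∉ T := by simp [hT]
  have hPτ : Projective (F (ir τ)) := by rw [hFP]; exact hP τ
  have hW : IsWide (fun Y : ModuleCat.{u} A => ∀ u, u ∈ UU jj t ∧ u < s → rperp Y (F u)) :=
    IsWide.all fun u => IsWide.imp (wide_l hA (F u))
  obtain ⟨L, l1, l2, l3, l4⟩ := reds K hA F T (hTE.mono (Finset.subset_insert _ _)) hW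
    (fun u hu v hv => by
      rw [hT, Finset.mem_filter] at hu
      exact hF.2 v hv.1 u hu.1 (hv.2.trans hu.2.1))
    (F (ir τ)) (hF.1 _ hτU).fd (fun v hv => hF.2 v hv.1 _ hτU (hv.2.trans hsτ))
  have hLz : ¬ Limits.IsZero L := fun hL => mut_nz K hA hτT hTE hPτ fun Y hY =>
    (l4 Y hY).2 fun f => hL.eq_of_src _ _
  have hTslot : ∀ Y, Slot F (UU jj (t+1)) s Y → ∀ u ∈ T, rperp (F u) Y := by
    intro Y hY u hu
    rw [hT, Finset.mem_filter] at hu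
    exact hY.1 u ⟨hnew u hu.1 hu.2.2, hu.2.1⟩
  have hLs : Slot F (UU jj (t+1)) s L := by
    constructor
    · intro u hu
      have := hold u hu.1 hu.2.ne'
      exact l3 u (by rw [hT, Finset.mem_filter]; exact ⟨this.1, hu.2, this.2⟩)
    · intro u hu
      exact l2 u ⟨(hold u hu.1 hu.2.ne).1, hu.2⟩
  obtain ⟨X, x1, x2, x3⟩ := minProj K hA (slot_wide hA s) L l1 hLs hLz
    (fun Y hY => (l4 Y (hTslot Y hY)).1 (extZero_of_projective hPτ _))
  refine ⟨X, ⟨?_, ?_⟩, ?_⟩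
  · intro u hu
    by_cases hus : u = s
    · rw [hus, Function.update_self]; exact x1
    · rw [Function.update_of_ne hus]; exact hF.1 u (hold u hu hus).1
  · intro u hu v hv huv
    by_cases hus : u = s
    · have hvs : v ≠ s := hus ▸ huv.ne'
      rw [hus, Function.update_self, Function.update_of_ne hvs]
      exact x2.1 v ⟨hv, hus ▸ huv⟩
    · by_cases hvs : v = s
      · rw [hvs, Function.update_self, Function.update_of_ne hus]
        exact x2.2 u ⟨hu, hvs ▸ huv⟩
      · rw [Function.update_of_ne hus, Function.update_of_ne hvs]
        exact hF.2 u (hold u hu hus).1 v (hold v hv hvs).1 huv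
  · intro m q hm hq hqm
    by_cases hqs : (il q : Om n k) = s
    · rw [hqs, Function.update_self]
      have hqj : q = jj τ := il_inj.1 hqs
      have hmt : m < τ := by
        have : m ≠ τ := fun h => hqm (by rw [hqj, h])
        rw [Fin.lt_def]
        have h2 : m.val ≠ t := fun h => this (Fin.ext h)
        simp only [hτ]; omega
      have hmt' : m.val < t := hmt
      refine homZero_of_chi K (hPe m).fd x1.fd (extZero_of_projective (hP m) _) ?_
      obtain ⟨a, ha⟩ := coef K hA hF (UU_card jj hk hj ht.le) hmax (hPe m).fd
      have h1 := tri_up K hF a (fun u => ∃ m', u = ir m')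
        (by
          rintro _ v ⟨m', rfl⟩ hv
          rcases Om.cases v with ⟨q, rfl⟩ | h
          · exact absurd hv (not_ir_lt_il _ _)
          · exact h)
        (by
          rintro _ hu ⟨m', rfl⟩
          rw [← ha, lf_d, hFP]
          refine chi_of_rperp K (hPP m m' ?_)
          have := (mem_ir jj).1 hu
          rw [Fin.lt_def]; omega)
      have h2 := tri_down K hF a (fun u => u < il (jj m)) (fun u v h h' => h'.trans h)
        (by
          intro u hu hlt
          rcases Om.cases u with ⟨q', rfl⟩ | ⟨m', rfl⟩
          · rw [← ha, rf_d]
            exact chi_of_rperp K ⟨hz m q' hmt' hu (il_lt_il.1 hlt).ne,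
              extZero_of_projective (hP m) _⟩
          · exact absurd hlt (not_ir_lt_il _ _))
      rw [← rf_d K x1.fd, ha, map_sum, Finset.sum_eq_zero]
      intro u hu
      rcases Om.cases u with ⟨q', rfl⟩ | ⟨m', rfl⟩
      · by_cases hq' : q' < jj m
        · rw [h2 _ hu (il_lt_il.2 hq'), zero_smul, map_zero]
        · rw [map_smul, rf_d, chi_of_rperp K (x2.1 (il q') ⟨hnew _ hu il_ne_ir,
            il_lt_il.2 ((hj hmt).trans_le (not_lt.1 hq'))⟩), smul_zero]
      · rw [h1 _ hu ⟨m', rfl⟩, zero_smul, map_zero]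
    · rw [Function.update_of_ne hqs]
      have hqU := (hold _ hq hqs).1
      by_cases hmt : m.val < t
      · exact hz m q hmt hqU hqm
      · have : m = τ := Fin.ext (by simp only [hτ]; omega)
        rw [this, ← hFP]
        exact (hF.2 _ hqU _ hτU (il_lt_ir _ _)).1

include K in
theorem corr_surj {E' : Fin n → ModuleCat.{u} A} (hE : CompleteES E')
    (hpr : ∀ i : Fin k, Projective (E' ⟨n - k + i.val, bnd hk i⟩)) :
    ∃ E : Fin n → ModuleCat.{u} A, (CompleteES E ∧
      ∀ m, RelProj E (jj m) ∧ RelInj E (jj m)) ∧ Corr jj hj E E' := by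
  let P : Fin k → ModuleCat.{u} A := fun i => E' ⟨n - k + i.val, bnd hk i⟩
  have hPe : ∀ m, ExceptionalMod (P m) := fun m => hE.1.1 _
  have hPP : ∀ m m', m < m' → rperp (P m') (P m) := fun m m' h => hE.1.2 _ _ (by
    rw [Fin.lt_def] at h ⊢; simp only; omega)
  have hinj := (e0_mono jj hk hj).injective
  let F₀ : Om n k → ModuleCat.{u} A := Function.extend (e0 jj hj) E' (fun _ => regA A)
  have hF₀ : ∀ i, F₀ (e0 jj hj i) = E' i := fun i => hinj.extend_apply _ _ i
  have main : ∀ t, t ≤ k → ∃ F : Om n k → ModuleCat.{u} A, ExcOn F (UU jj t) ∧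
      (∀ m, F (ir m) = P m) ∧ (∀ q, il q ∈ UU jj 0 → F (il q) = F₀ (il q)) ∧
      ∀ m q, m.val < t → il q ∈ UU jj t → q ≠ jj m → homZero (P m) (F (il q)) := by
    intro t
    induction t with
    | zero =>
      intro _
      refine ⟨F₀, ⟨?_, ?_⟩, ?_, fun _ _ => rfl, fun m q h => absurd h (by omega)⟩
      · intro u hu
        obtain ⟨i, rfl⟩ := e0_surj jj hk hj hu
        rw [hF₀]; exact hE.1.1 i
      · intro u hu v hv huv
        obtain ⟨i, rfl⟩ := e0_surj jj hk hj hu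
        obtain ⟨i', rfl⟩ := e0_surj jj hk hj hv
        rw [hF₀, hF₀]
        exact hE.1.2 _ _ ((e0_mono jj hk hj).lt_iff_lt.1 huv)
      · intro m
        rw [← e0_ir jj hk hj m, hF₀]
    | succ t ih =>
      intro ht
      obtain ⟨F, f1, f2, f3, f4⟩ := ih (by omega)
      obtain ⟨X, x1, x2⟩ := surj_step K hA hk hj hpr hPe hPP hE.2 ht f1 f2 f4
      refine ⟨_, x1, ?_, ?_, x2⟩
      · intro m
        rw [Function.update_of_ne il_ne_ir.symm]; exact f2 m
      · intro q hq
        rw [Function.update_of_ne]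
        · exact f3 q hq
        · intro h
          exact (mem_il jj).1 hq ⟨t, ht⟩ (Nat.zero_le _) (il_inj.1 h).symm
  obtain ⟨F, f1, f2, f3, f4⟩ := main k le_rfl
  have hk' : ∀ q, il q ∈ UU jj k := fun q => (mem_il jj).2 fun m hm => absurd m.isLt (by omega)
  have hc : CompleteES (fun q => F (il q)) := ⟨⟨fun q => f1.1 _ (hk' q), fun q q' h =>
    f1.2 _ (hk' q) _ (hk' q') (il_lt_il.2 h)⟩, hE.2⟩
  have hg : Good jj (fun q => F (il q)) P := ⟨hc, hpr, hPe, fun m q => f4 m q m.isLt (hk' q)⟩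
  refine ⟨fun q => F (il q), ⟨hc, fun m => root_bwd K hA hc (jj m) (hpr m) (hPe m) (hg.hz m)⟩,
    P, hg, fun i => ⟨eqToIso ?_⟩⟩
  have hm := e0_mem jj hj i
  have h0 := hF₀ i
  rcases Om.cases (e0 jj hj i) with ⟨q, hq⟩ | ⟨m, hm'⟩
  · rw [hq] at hm h0 ⊢
    rw [cmb_il, f3 q hm, h0]
  · rw [hm', cmb_ir]
    show E' i = E' _
    congr 1
    exact hinj (by rw [hm', e0_ir jj hk hj m])

end surj
end ExcSeq

namespace ExcSeq
/-- Fix indices `j₁ < ⋯ < j_k`. Over a finite-dimensional hereditary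
algebra, the number of complete exceptional sequences in which each `E_{jᵢ}` is both
relatively projective and relatively injective equals the number of complete exceptional
sequences whose last `k` terms are projective modules; in particular it is independent
of the choice of indices. -/
theorem stmt12 {K : Type u} [Field K] {A : Type u} [Ring A] [Algebra K A]
    [FiniteDimensional K A] (hA : Hereditary A)
    {n k : ℕ} (hk : k ≤ n) (j : Fin k → Fin n) (hj : StrictMono j) :
    isoClassCount {E : Fin n → ModuleCat.{u} A |
        CompleteES E ∧ ∀ i : Fin k, RelProj E (j i) ∧ RelInj E (j i)}
      = isoClassCount {E : Fin n → ModuleCat.{u} A |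
          CompleteES E ∧
            ∀ i : Fin k, Projective (E ⟨n - k + i.val, by have := i.isLt; omega⟩)} := by
  have hj' : StrictAnti (fun i => j (Fin.rev i)) := fun a b h => hj (Fin.rev_lt_rev.2 h)
  unfold isoClassCount
  refine card_rel _ _ (fun a b => Corr (fun i => j (Fin.rev i)) hj' a.1 b.1) ?_ ?_ ?_ ?_
  · rintro ⟨E, hE, hr⟩
    obtain ⟨E', h1, h2⟩ := corr_total K hA hk hj' hE (fun m => hr (Fin.rev m))
    exact ⟨⟨E', h1⟩, h2⟩
  · rintro ⟨E', hE, hr⟩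
    obtain ⟨E, h1, h2⟩ := corr_surj K hA hk hj' hE hr
    refine ⟨⟨E, h1.1, fun i => ?_⟩, h2⟩
    have := h1.2 (Fin.rev i)
    simp only [Fin.rev_rev] at this
    exact this
  · intro a a' b b' h1 h2 h
    exact corr_fn K hA hj' h1 h2 h
  · intro a a' b b' h1 h2 h
    exact corr_inj K hA hk hj' h1 h2 h

end ExcSeq
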